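/- arXiv:1906.03562 — 7 statements merged into one kernel-verified Lean document; each statement's English description precedes it below -/
import Mathlib

section
/- Set A₁ = −g₁/(a₁+a₀), B₁ = g₁/a₀, E_{1,0} = −[(γ+θ)(A₁+B₁)K − A₁K]/(2θ), F_{1,0} = −[(γ−θ)(A₁+B₁)K − A₁K]/(2θ), and define C⁽¹⁾(s) = A₁s + B₁K + E_{1,0}(s/K)^{γ−θ} for s > K and C⁽¹⁾(s) = F_{1,0}(s/K)^{γ+θ} for 0 < s ≤ K. Then: (i) C⁽¹⁾ is twice differentiable on (0,K) and on (K,∞) and satisfies a₀C⁽¹⁾(s) + a₁s (C⁽¹⁾)′(s) + a₂s²(C⁽¹⁾)″(s) + g₁(s−K)⁺ = 0 there; (ii) the one-sided limits at s = K of C⁽¹⁾ and of its first derivative from the left and from the right coincide; (iii) lim_{s→0⁺} C⁽¹⁾(s) = 0. -/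
open Filter Topology

lemma aux_d (A B E K p s : ℝ) (hK : 0 < K) (hs : 0 < s) :
    HasDerivAt (fun x : ℝ => A * x + B + E * (x / K) ^ p) (A + E * (p / K * (s / K) ^ (p - 1))) s := by
  have h1 : HasDerivAt (fun x : ℝ => x / K) (1 / K) s := (hasDerivAt_id s).div_const K
  have h2 := h1.rpow_const (p := p) (Or.inl (div_pos hs hK).ne')
  have h3 := (((hasDerivAt_id s).const_mul A).add_const B).add (h2.const_mul E)
  refine (h3.congr_deriv ?_)
  ring

/-- local analysis of a function that agrees with affine + power on an open set -/
lemma aux_main (A B E K p : ℝ) (hK : 0 < K) (C : ℝ → ℝ) (U : Set ℝ) (hU : IsOpen U)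
    (hpos : ∀ x ∈ U, 0 < x) (hC : ∀ x ∈ U, C x = A * x + B + E * (x / K) ^ p) :
    (∀ s ∈ U, DifferentiableAt ℝ C s) ∧
    (∀ s ∈ U, deriv C s = A + E * (p / K * (s / K) ^ (p - 1))) ∧
    (∀ s ∈ U, DifferentiableAt ℝ (deriv C) s ∧
      deriv (deriv C) s = E * (p / K * ((p - 1) / K * (s / K) ^ (p - 1 - 1)))) := by
  have h1 : ∀ s ∈ U, HasDerivAt C (A + E * (p / K * (s / K) ^ (p - 1))) s := by
    intro s hs
    refine (aux_d A B E K p s hK (hpos s hs)).congr_of_eventuallyEq ?_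
    filter_upwards [hU.mem_nhds hs] with x hx using hC x hx
  refine ⟨fun s hs => (h1 s hs).differentiableAt, fun s hs => (h1 s hs).deriv, ?_⟩
  intro s hs
  have h2 : HasDerivAt (deriv C) (E * (p / K * ((p - 1) / K * (s / K) ^ (p - 1 - 1)))) s := by
    have h := aux_d 0 A (E * (p / K)) K (p - 1) s hK (hpos s hs)
    refine (h.congr_of_eventuallyEq ?_).congr_deriv (by ring)
    filter_upwards [hU.mem_nhds hs] with x hx
    rw [(h1 x hx).deriv]; ring
  exact ⟨h2.differentiableAt, h2.deriv⟩

lemma aux_ode (A B E K p s a₀ a₁ a₂ : ℝ) (hK : 0 < K) (hs : 0 < s)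
    (hp : a₀ + a₁ * p + a₂ * p * (p - 1) = 0) :
    a₀ * (A * s + B + E * (s / K) ^ p) + a₁ * s * (A + E * (p / K * (s / K) ^ (p - 1)))
      + a₂ * s ^ 2 * (E * (p / K * ((p - 1) / K * (s / K) ^ (p - 1 - 1))))
      = (a₀ + a₁) * A * s + a₀ * B := by
  have hx : 0 < s / K := div_pos hs hK
  have e1 : (s / K) ^ p = (s / K) ^ (p - 1 - 1) * (s / K) ^ 2 := by
    rw [← Real.rpow_natCast, ← Real.rpow_add hx]; congr 1; push_cast; ring
  have e2 : (s / K) ^ (p - 1) = (s / K) ^ (p - 1 - 1) * (s / K) := by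
    nth_rewrite 3 [← Real.rpow_one (s / K)]
    rw [← Real.rpow_add hx]; congr 1; ring
  rw [e1, e2]
  generalize (s / K) ^ (p - 1 - 1) = Y
  linear_combination (E * Y * (s / K) ^ 2) * hp

/-- The single-option randomized-maturity value C⁽¹⁾ (affine plus power above the
strike, pure power below the strike) is twice differentiable away from K, satisfies
a₀C⁽¹⁾ + a₁sC⁽¹⁾′ + a₂s²C⁽¹⁾″ + g₁(s−K)⁺ = 0 there, has matching one-sided limits (of value and
first derivative) at s = K, and C⁽¹⁾(0⁺) = 0. -/
theorem stmt_4 (r q σ lam β κ K : ℝ)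
    (hr : 0 < r) (hq : 0 ≤ q) (hσ : 0 < σ) (hlam : 0 ≤ lam) (hβ : 0 ≤ β)
    (hκ : 0 < κ) (hK : 0 < K)
    (a₀ a₁ a₂ γ θ g₁ : ℝ)
    (ha₀ : a₀ = -(r + lam + β + κ)) (ha₁ : a₁ = r - q) (ha₂ : a₂ = σ ^ 2 / 2)
    (hγ : γ = 1 / 2 - (r - q) / σ ^ 2)
    (hθ : θ = Real.sqrt (γ ^ 2 + 2 * (r + lam + β + κ) / σ ^ 2))
    (hg₁ : g₁ = lam + β + κ)
    (A₁ B₁ E₁₀ F₁₀ : ℝ)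
    (hA₁ : A₁ = -g₁ / (a₁ + a₀)) (hB₁ : B₁ = g₁ / a₀)
    (hE₁₀ : E₁₀ = -(((γ + θ) * (A₁ + B₁) * K - A₁ * K) / (2 * θ)))
    (hF₁₀ : F₁₀ = -(((γ - θ) * (A₁ + B₁) * K - A₁ * K) / (2 * θ)))
    (C : ℝ → ℝ)
    (hC : ∀ s : ℝ, C s =
      if K < s then A₁ * s + B₁ * K + E₁₀ * (s / K) ^ (γ - θ)
      else F₁₀ * (s / K) ^ (γ + θ)) :
    (∀ s : ℝ, s ∈ Set.Ioo 0 K ∪ Set.Ioi K →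
      DifferentiableAt ℝ C s ∧ DifferentiableAt ℝ (deriv C) s ∧
      a₀ * C s + a₁ * s * deriv C s + a₂ * s ^ 2 * deriv (deriv C) s
        + g₁ * max (s - K) 0 = 0) ∧
    (∃ L : ℝ, Tendsto C (nhdsWithin K (Set.Iio K)) (nhds L) ∧
      Tendsto C (nhdsWithin K (Set.Ioi K)) (nhds L)) ∧
    (∃ L' : ℝ, Tendsto (deriv C) (nhdsWithin K (Set.Iio K)) (nhds L') ∧
      Tendsto (deriv C) (nhdsWithin K (Set.Ioi K)) (nhds L')) ∧
    Tendsto C (nhdsWithin 0 (Set.Ioi 0)) (nhds 0) := by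
  have hσ2 : 0 < σ ^ 2 := by positivity
  have hR : 0 < 2 * (r + lam + β + κ) / σ ^ 2 := by positivity
  have hθ2 : θ ^ 2 = γ ^ 2 + 2 * (r + lam + β + κ) / σ ^ 2 := by
    rw [hθ, Real.sq_sqrt (by positivity)]
  have hθpos : 0 < θ := by rw [hθ]; exact Real.sqrt_pos.mpr (by positivity)
  have hsum : 0 < γ + θ := by
    by_contra h
    nlinarith
  have ha₀n : a₀ ≠ 0 := by
    have : a₀ < 0 := by rw [ha₀]; linarith
    exact this.ne
  have ha₁n : a₁ + a₀ ≠ 0 := by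
    have : a₁ + a₀ < 0 := by rw [ha₀, ha₁]; linarith
    exact this.ne
  have hA : A₁ * (a₁ + a₀) = -g₁ := by rw [hA₁]; field_simp
  have hB : B₁ * a₀ = g₁ := by rw [hB₁]; field_simp
  have hγ2 : a₂ * (2 * γ) = a₂ - a₁ := by rw [ha₂, hγ, ha₁]; field_simp
  have hθ3 : a₂ * (θ ^ 2 - γ ^ 2) = -a₀ := by rw [hθ2, ha₂, ha₀]; field_simp; ring
  have hm : a₀ + a₁ * (γ - θ) + a₂ * (γ - θ) * (γ - θ - 1) = 0 := by
    linear_combination (γ - θ) * hγ2 + hθ3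
  have hp : a₀ + a₁ * (γ + θ) + a₂ * (γ + θ) * (γ + θ - 1) = 0 := by
    linear_combination (γ + θ) * hγ2 + hθ3
  have hEθ : E₁₀ * (2 * θ) = -((γ + θ) * (A₁ + B₁) * K - A₁ * K) := by
    rw [hE₁₀]; field_simp
  have hFθ : F₁₀ * (2 * θ) = -((γ - θ) * (A₁ + B₁) * K - A₁ * K) := by
    rw [hF₁₀]; field_simp
  have h2θ : 2 * θ ≠ 0 := by positivity
  have hc0 : A₁ * K + B₁ * K + E₁₀ = F₁₀ := by
    apply mul_right_cancel₀ h2θ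
    linear_combination hEθ - hFθ
  have hc1 : A₁ * K + E₁₀ * (γ - θ) = F₁₀ * (γ + θ) := by
    apply mul_right_cancel₀ h2θ
    linear_combination (γ - θ) * hEθ - (γ + θ) * hFθ
  have hCu : ∀ x ∈ Set.Ioi K, C x = A₁ * x + B₁ * K + E₁₀ * (x / K) ^ (γ - θ) := by
    intro x hx
    rw [hC, if_pos (Set.mem_Ioi.mp hx)]
  have hCl : ∀ x ∈ Set.Ioo 0 K, C x = 0 * x + 0 + F₁₀ * (x / K) ^ (γ + θ) := by
    intro x hx
    rw [hC, if_neg (not_lt.mpr hx.2.le)]; ring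
  obtain ⟨u1, u2, u3⟩ := aux_main A₁ (B₁ * K) E₁₀ K (γ - θ) hK C (Set.Ioi K) isOpen_Ioi
    (fun x hx => hK.trans hx) hCu
  obtain ⟨l1, l2, l3⟩ := aux_main 0 0 F₁₀ K (γ + θ) hK C (Set.Ioo 0 K) isOpen_Ioo
    (fun x hx => hx.1) hCl
  have hlK : Set.Ioo 0 K ∈ 𝓝[<] K := Ioo_mem_nhdsLT hK
  have huK : Set.Ioi K ∈ 𝓝[>] K := self_mem_nhdsWithin
  -- continuity at `K` of affine plus power
  have hcont : ∀ A B E p : ℝ, Tendsto (fun x : ℝ => A * x + B + E * (x / K) ^ p) (𝓝 K)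
      (𝓝 (A * K + B + E)) := by
    intro A B E p
    have h := (aux_d A B E K p K hK hK).continuousAt.tendsto
    simpa [div_self hK.ne'] using h
  refine ⟨?_, ⟨F₁₀, ?_, ?_⟩, ⟨F₁₀ * ((γ + θ) / K), ?_, ?_⟩, ?_⟩
  · rintro s (hs | hs)
    · refine ⟨l1 s hs, (l3 s hs).1, ?_⟩
      rw [l2 s hs, (l3 s hs).2, hCl s hs, aux_ode 0 0 F₁₀ K (γ + θ) s a₀ a₁ a₂ hK hs.1 hp,
        max_eq_right (by linarith [hs.2])]
      ring
    · have hs' : K < s := hs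
      refine ⟨u1 s hs, (u3 s hs).1, ?_⟩
      rw [u2 s hs, (u3 s hs).2, hCu s hs,
        aux_ode A₁ (B₁ * K) E₁₀ K (γ - θ) s a₀ a₁ a₂ hK (hK.trans hs') hm,
        max_eq_left (by linarith)]
      linear_combination s * hA + K * hB
  · have h := (hcont 0 0 F₁₀ (γ + θ)).mono_left (nhdsWithin_le_nhds (s := Set.Iio K))
    rw [show 0 * K + 0 + F₁₀ = F₁₀ by ring] at h
    refine h.congr' ?_
    filter_upwards [hlK] with x hx using (hCl x hx).symm
  · have h := (hcont A₁ (B₁ * K) E₁₀ (γ - θ)).mono_left (nhdsWithin_le_nhds (s := Set.Ioi K))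
    rw [hc0] at h
    refine h.congr' ?_
    filter_upwards [huK] with x hx using (hCu x hx).symm
  · have h := (hcont 0 0 (F₁₀ * ((γ + θ) / K)) (γ + θ - 1)).mono_left
      (nhdsWithin_le_nhds (s := Set.Iio K))
    rw [show 0 * K + 0 + F₁₀ * ((γ + θ) / K) = F₁₀ * ((γ + θ) / K) by ring] at h
    refine h.congr' ?_
    filter_upwards [hlK] with x hx
    rw [l2 x hx]; ring
  · have h := (hcont 0 A₁ (E₁₀ * ((γ - θ) / K)) (γ - θ - 1)).mono_left
      (nhdsWithin_le_nhds (s := Set.Ioi K))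
    have e : 0 * K + A₁ + E₁₀ * ((γ - θ) / K) = F₁₀ * ((γ + θ) / K) := by
      field_simp
      linear_combination hc1
    rw [e] at h
    refine h.congr' ?_
    filter_upwards [huK] with x hx
    rw [u2 x hx]; ring
  · have h1 : Tendsto (fun x : ℝ => F₁₀ * (x / K) ^ (γ + θ)) (𝓝 0) (𝓝 0) := by
      have hc : ContinuousAt (fun x : ℝ => F₁₀ * (x / K) ^ (γ + θ)) 0 :=
        ((continuousAt_id.div_const K).rpow_const (Or.inr hsum.le)).const_mul F₁₀
      have := hc.tendsto
      simpa [Real.zero_rpow hsum.ne'] using this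
    refine (h1.mono_left nhdsWithin_le_nhds).congr' ?_
    filter_upwards [Ioo_mem_nhdsGT hK] with x hx
    rw [hCl x hx]; ring
end

section
/- For fixed r>0, q≥0, σ>0, λ≥0, β≥0, K>0 and for each κ>0 let C⁽¹⁾(s;κ) denote the single-option randomized-maturity value: C⁽¹⁾(s;κ) = A₁s + B₁K + E_{1,0}(s/K)^{γ−θ} for s > K and C⁽¹⁾(s;κ) = F_{1,0}(s/K)^{γ+θ} for 0 < s ≤ K, where A₁ = −g₁/(a₁+a₀), B₁ = g₁/a₀, E_{1,0} = −[(γ+θ)(A₁+B₁)K − A₁K]/(2θ), F_{1,0} = −[(γ−θ)(A₁+B₁)K − A₁K]/(2θ), all coefficients depending on κ through a₀, g₁ and θ. Then for every s > 0, lim_{κ→∞} C⁽¹⁾(s;κ) = (s − K)⁺. -/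
open Filter Topology

/-- As the maturity-randomization rate κ → ∞, the single-option
randomized-maturity value C⁽¹⁾(s;κ) converges to the payoff (s − K)⁺, for every s > 0. -/
theorem stmt_5 (r q σ lam β K : ℝ)
    (hr : 0 < r) (hq : 0 ≤ q) (hσ : 0 < σ) (hlam : 0 ≤ lam) (hβ : 0 ≤ β) (hK : 0 < K)
    (s : ℝ) (hs : 0 < s) :
    Tendsto (fun κ : ℝ =>
      let a₀ : ℝ := -(r + lam + β + κ)
      let a₁ : ℝ := r - q
      let γ : ℝ := 1 / 2 - (r - q) / σ ^ 2
      let θ : ℝ := Real.sqrt (γ ^ 2 + 2 * (r + lam + β + κ) / σ ^ 2)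
      let g₁ : ℝ := lam + β + κ
      let A₁ : ℝ := -g₁ / (a₁ + a₀)
      let B₁ : ℝ := g₁ / a₀
      let E₁₀ : ℝ := -(((γ + θ) * (A₁ + B₁) * K - A₁ * K) / (2 * θ))
      let F₁₀ : ℝ := -(((γ - θ) * (A₁ + B₁) * K - A₁ * K) / (2 * θ))
      if K < s then A₁ * s + B₁ * K + E₁₀ * (s / K) ^ (γ - θ)
      else F₁₀ * (s / K) ^ (γ + θ))
      atTop (nhds (max (s - K) 0)) := by
  dsimp only
  set γ : ℝ := 1 / 2 - (r - q) / σ ^ 2 with hγ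
  have hlin : ∀ c : ℝ, Tendsto (fun κ : ℝ => c + κ) atTop atTop := fun c =>
    tendsto_atTop_add_const_left _ _ tendsto_id
  have hθ : Tendsto (fun κ : ℝ => Real.sqrt (γ ^ 2 + 2 * (r + lam + β + κ) / σ ^ 2))
      atTop atTop := by
    apply Real.tendsto_sqrt_atTop.comp
    apply tendsto_atTop_add_const_left
    apply Tendsto.atTop_div_const (by positivity)
    exact Tendsto.const_mul_atTop (by norm_num) (hlin _)
  generalize hθd : (fun κ : ℝ => Real.sqrt (γ ^ 2 + 2 * (r + lam + β + κ) / σ ^ 2)) = θ at hθ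
  have hθe : ∀ κ, Real.sqrt (γ ^ 2 + 2 * (r + lam + β + κ) / σ ^ 2) = θ κ := fun κ => by
    rw [← hθd]
  simp only [hθe]
  have hA : Tendsto (fun κ : ℝ => -(lam + β + κ) / (r - q + -(r + lam + β + κ))) atTop (𝓝 1) := by
    have h : Tendsto (fun κ : ℝ => 1 - q * ((q + lam + β) + κ)⁻¹) atTop (𝓝 (1 - q * 0)) :=
      ((tendsto_inv_atTop_zero.comp (hlin _)).const_mul q).const_sub 1
    rw [mul_zero, sub_zero] at h
    refine h.congr' ?_
    filter_upwards [eventually_gt_atTop 0] with κ hκ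
    have h1 : (q + lam + β) + κ ≠ 0 := by positivity
    have h2 : r - q + -(r + lam + β + κ) = -((q + lam + β) + κ) := by ring
    rw [h2, neg_div_neg_eq]
    field_simp
    ring
  have hB : Tendsto (fun κ : ℝ => (lam + β + κ) / (-(r + lam + β + κ))) atTop (𝓝 (-1)) := by
    have h : Tendsto (fun κ : ℝ => r * ((r + lam + β) + κ)⁻¹ - 1) atTop (𝓝 (r * 0 - 1)) :=
      ((tendsto_inv_atTop_zero.comp (hlin _)).const_mul r).sub_const 1
    rw [mul_zero, zero_sub] at h
    refine h.congr' ?_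
    filter_upwards [eventually_gt_atTop 0] with κ hκ
    have h1 : r + lam + β + κ ≠ 0 := by positivity
    rw [div_neg]
    field_simp
    ring
  have hti : Tendsto (fun κ => (θ κ)⁻¹) atTop (𝓝 0) := tendsto_inv_atTop_zero.comp hθ
  have key : ∀ (A B : ℝ → ℝ), Tendsto A atTop (𝓝 1) → Tendsto B atTop (𝓝 (-1)) →
      Tendsto (fun κ => if K < s then A κ * s + B κ * K +
          -(((γ + θ κ) * (A κ + B κ) * K - A κ * K) / (2 * θ κ)) * (s / K) ^ (γ - θ κ)
        else -(((γ - θ κ) * (A κ + B κ) * K - A κ * K) / (2 * θ κ)) * (s / K) ^ (γ + θ κ))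
        atTop (𝓝 (max (s - K) 0)) := by
    intro A B hA hB
    have coef : ∀ e : ℝ, Tendsto (fun κ =>
        -(((γ + e * θ κ) * (A κ + B κ) * K - A κ * K) / (2 * θ κ))) atTop (𝓝 0) := by
      intro e
      have h := ((((hti.const_mul γ).add_const e).mul (hA.add hB)).mul_const K).sub
        ((hA.mul_const K).mul hti) |>.div_const (-2)
      have h0 : ((γ * 0 + e) * (1 + -1) * K - 1 * K * 0) / (-2) = (0 : ℝ) := by ring
      rw [h0] at h
      refine h.congr' ?_
      filter_upwards [hθ.eventually_gt_atTop 0] with κ hκ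
      field_simp
    by_cases hsK : K < s
    · simp only [hsK, if_true]
      have hE := coef 1
      simp only [one_mul] at hE
      have hz := bdd_le_mul_tendsto_zero' 1 (f := fun κ => (s / K) ^ (γ - θ κ)) (by
        filter_upwards [hθ.eventually_ge_atTop γ] with κ hκ
        rw [abs_of_nonneg (by positivity)]
        exact Real.rpow_le_one_of_one_le_of_nonpos ((one_le_div hK).2 hsK.le) (by linarith)) hE
      have h := ((hA.mul_const s).add (hB.mul_const K)).add hz
      rw [max_eq_left (by linarith)]
      convert h using 2
      · ring
      · ring
    · simp only [hsK, if_false]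
      have hE := coef (-1)
      simp only [neg_mul, one_mul, ← sub_eq_add_neg] at hE
      have hz := bdd_le_mul_tendsto_zero' 1 (f := fun κ => (s / K) ^ (γ + θ κ)) (by
        filter_upwards [hθ.eventually_ge_atTop (-γ)] with κ hκ
        rw [abs_of_nonneg (by positivity)]
        exact Real.rpow_le_one (by positivity) ((div_le_one hK).2 (not_lt.1 hsK))
          (by linarith)) hE
      rw [max_eq_right (by linarith)]
      convert hz using 2
      ring
  exact key _ _ hA hB
end

section
/- Let the coefficients A_m, B_m, E_{m,n} (1 ≤ m ≤ M, 0 ≤ n ≤ m−1) be defined by the Proposition's recursions, and for each m define C⁽ᵐ⁾(s) = A_m s + B_m K + Σ_{n=0}^{m−1} E_{m,n}(ln(s/K))ⁿ(s/K)^{γ−θ} for s > K. Then for every 1 ≤ m ≤ M, C⁽ᵐ⁾ is twice differentiable on (K,∞) and satisfies, for all s > K, a₀C⁽ᵐ⁾(s) + a₁s(C⁽ᵐ⁾)′(s) + a₂s²(C⁽ᵐ⁾)″(s) + λ·Σ_{z=1}^{m−1} p_{m,z}C⁽ᵐ⁻ᶻ⁾(s) + g_m(s−K) = 0. -/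
open Polynomial in
/-- derivative of a polynomial in the logarithm times a power -/
lemma hasDerivAt_logpoly (P : ℝ[X]) (K α s : ℝ) (hK : 0 < K) (hs : 0 < s) :
    HasDerivAt (fun x : ℝ => P.eval (Real.log (x / K)) * (x / K) ^ α)
      ((derivative P + C α * P).eval (Real.log (s / K)) * (s / K) ^ α / s) s := by
  have hx : 0 < s / K := div_pos hs hK
  have h0 : HasDerivAt (fun x : ℝ => x / K) (1 / K) s := (hasDerivAt_id s).div_const K
  have h1 := h0.log hx.ne'
  have h2 := (P.hasDerivAt (Real.log (s / K))).comp s h1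
  have h3 := h0.rpow_const (p := α) (Or.inl hx.ne')
  have h4 := h2.mul h3
  refine h4.congr_deriv ?_
  rw [Real.rpow_sub_one hx.ne']
  simp only [eval_add, eval_mul, eval_C, Function.comp]
  field_simp

open Polynomial in
lemma coeff_Esum (e : ℕ → ℝ) (m k : ℕ) :
    (∑ n ∈ Finset.range m, C (e n) * X ^ n : ℝ[X]).coeff k = if k < m then e k else 0 := by
  simp [finset_sum_coeff, coeff_C_mul, coeff_X_pow]

/-- With the coefficients A_m, B_m, E_{m,n} (and companion F_{m,n}) defined by the
Proposition's recursions, the above-strike piece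
C⁽ᵐ⁾(s) = A_m s + B_m K + Σ_{n=0}^{m−1} E_{m,n}(ln(s/K))ⁿ(s/K)^{γ−θ}
is twice differentiable on (K,∞) and satisfies there
a₀C⁽ᵐ⁾ + a₁sC⁽ᵐ⁾′ + a₂s²C⁽ᵐ⁾″ + λΣ_{z=1}^{m−1}p_{m,z}C⁽ᵐ⁻ᶻ⁾ + g_m(s−K) = 0. -/
theorem stmt_6 (r q σ lam β κ K : ℝ)
    (hr : 0 < r) (hq : 0 ≤ q) (hσ : 0 < σ) (hlam : 0 ≤ lam) (hβ : 0 ≤ β)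
    (hκ : 0 < κ) (hK : 0 < K)
    (a₀ a₁ a₂ γ θ : ℝ)
    (ha₀ : a₀ = -(r + lam + β + κ)) (ha₁ : a₁ = r - q) (ha₂ : a₂ = σ ^ 2 / 2)
    (hγ : γ = 1 / 2 - (r - q) / σ ^ 2)
    (hθ : θ = Real.sqrt (γ ^ 2 + 2 * (r + lam + β + κ) / σ ^ 2))
    (M : ℕ) (hM : 1 ≤ M)
    (p : ℕ → ℕ → ℝ)
    (hp_nonneg : ∀ m z, 1 ≤ m → m ≤ M → 1 ≤ z → z ≤ m → 0 ≤ p m z)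
    (hp_sum : ∀ m, 1 ≤ m → m ≤ M → ∑ z ∈ Finset.Icc 1 m, p m z = 1)
    (pbar g : ℕ → ℝ)
    (hpbar : ∀ m, pbar m = ∑ z ∈ Finset.Icc 1 m, (z : ℝ) * p m z)
    (hg : ∀ m, g m = lam * pbar m + (m : ℝ) * (β + κ))
    (A B : ℕ → ℝ) (E F : ℕ → ℕ → ℝ)
    (hA : ∀ m, 1 ≤ m → m ≤ M →
      A m = (-lam * ∑ z ∈ Finset.Icc 1 (m - 1), p m z * A (m - z) - g m) / (a₁ + a₀))
    (hB : ∀ m, 1 ≤ m → m ≤ M →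
      B m = (-lam * ∑ z ∈ Finset.Icc 1 (m - 1), p m z * B (m - z) + g m) / a₀)
    (hE₁₀ : E 1 0 = -(((γ + θ) * (A 1 + B 1) * K - A 1 * K) / (2 * θ)))
    (hF₁₀ : F 1 0 = -(((γ - θ) * (A 1 + B 1) * K - A 1 * K) / (2 * θ)))
    (hEtop : ∀ m, 2 ≤ m → m ≤ M →
      E m (m - 1) = -(lam * p m 1 * E (m - 1) (m - 2))
        / (((m : ℝ) - 1) * (a₁ + 2 * a₂ * (γ - θ) - a₂)))
    (hFtop : ∀ m, 2 ≤ m → m ≤ M →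
      F m (m - 1) = -(lam * p m 1 * F (m - 1) (m - 2))
        / (((m : ℝ) - 1) * (a₁ + 2 * a₂ * (γ + θ) - a₂)))
    (hEmid : ∀ m, 2 ≤ m → m ≤ M → ∀ n, 1 ≤ n → n ≤ m - 2 →
      E m n = -((lam * ∑ z ∈ Finset.Icc 1 (m - n), p m z * E (m - z) (n - 1)
          + ((n : ℝ) + 1) * (n : ℝ) * a₂ * E m (n + 1))
        / ((n : ℝ) * (a₁ + 2 * a₂ * (γ - θ) - a₂))))
    (hFmid : ∀ m, 2 ≤ m → m ≤ M → ∀ n, 1 ≤ n → n ≤ m - 2 →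
      F m n = -((lam * ∑ z ∈ Finset.Icc 1 (m - n), p m z * F (m - z) (n - 1)
          + ((n : ℝ) + 1) * (n : ℝ) * a₂ * F m (n + 1))
        / ((n : ℝ) * (a₁ + 2 * a₂ * (γ + θ) - a₂))))
    (hE₀ : ∀ m, 2 ≤ m → m ≤ M →
      E m 0 = -(((A m + B m) * K * (γ + θ) - A m * K + F m 1 - E m 1) / (2 * θ)))
    (hF₀ : ∀ m, 2 ≤ m → m ≤ M →
      F m 0 = -(((A m + B m) * K * (γ - θ) - A m * K + F m 1 - E m 1) / (2 * θ)))
    (C : ℕ → ℝ → ℝ)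
    (hC : ∀ m s, C m s = A m * s + B m * K
      + ∑ n ∈ Finset.range m, E m n * (Real.log (s / K)) ^ n * (s / K) ^ (γ - θ)) :
    ∀ m, 1 ≤ m → m ≤ M → ∀ s : ℝ, K < s →
      DifferentiableAt ℝ (C m) s ∧ DifferentiableAt ℝ (deriv (C m)) s ∧
      a₀ * C m s + a₁ * s * deriv (C m) s + a₂ * s ^ 2 * deriv (deriv (C m)) s
        + lam * ∑ z ∈ Finset.Icc 1 (m - 1), p m z * C (m - z) s
        + g m * (s - K) = 0 := by
  intro m hm1 hmM s hs
  have hσ2 : 0 < σ ^ 2 := by positivity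
  have hrad : 0 < γ ^ 2 + 2 * (r + lam + β + κ) / σ ^ 2 := by positivity
  have hθpos : 0 < θ := by rw [hθ]; exact Real.sqrt_pos.mpr hrad
  have hθ2 : θ ^ 2 = γ ^ 2 + 2 * (r + lam + β + κ) / σ ^ 2 := by
    rw [hθ]; exact Real.sq_sqrt hrad.le
  have hθ2' : σ ^ 2 * θ ^ 2 = σ ^ 2 * γ ^ 2 - 2 * a₀ := by
    rw [hθ2, ha₀]; field_simp; ring
  have hγ' : σ ^ 2 * γ = a₂ - a₁ := by
    rw [hγ, ha₁, ha₂]; field_simp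
  have hc : a₁ + 2 * a₂ * (γ - θ) - a₂ = -(σ ^ 2 * θ) := by
    rw [ha₂] at hγ' ⊢; linear_combination hγ'
  have hc0 : a₁ + 2 * a₂ * (γ - θ) - a₂ ≠ 0 := by
    rw [hc]; exact neg_ne_zero.mpr (by positivity)
  have hchar : a₀ + a₁ * (γ - θ) + a₂ * ((γ - θ) ^ 2 - (γ - θ)) = 0 := by
    have h1 : a₁ = a₂ - σ ^ 2 * γ := by linarith
    rw [h1, ha₂]
    linear_combination (1 / 2) * hθ2'
  have ha₀0 : a₀ ≠ 0 := by rw [ha₀]; exact neg_ne_zero.mpr (by positivity)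
  have ha₁₀ : a₁ + a₀ ≠ 0 := by
    have : a₁ + a₀ = -(q + lam + β + κ) := by rw [ha₁, ha₀]; ring
    rw [this]; exact neg_ne_zero.mpr (by positivity)
  generalize hα : γ - θ = α at *
  generalize hcc : a₁ + 2 * a₂ * α - a₂ = c at *
  let P : ℕ → Polynomial ℝ := fun m =>
    ∑ n ∈ Finset.range m, Polynomial.C (E m n) * Polynomial.X ^ n
  have hPc : ∀ m k, (P m).coeff k = if k < m then E m k else 0 := fun m k => coeff_Esum (E m) m k
  let D : Polynomial ℝ → Polynomial ℝ := fun Q => Polynomial.derivative Q + Polynomial.C α * Q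
  have hCP : ∀ m s, C m s = A m * s + B m * K
      + (P m).eval (Real.log (s / K)) * (s / K) ^ α := by
    intro m s
    rw [hC, Polynomial.eval_finset_sum, Finset.sum_mul]
    simp
  have hd1 : ∀ x, 0 < x → HasDerivAt (C m)
      (A m + (D (P m)).eval (Real.log (x / K)) * (x / K) ^ α / x) x := by
    intro x hx
    have h := ((((hasDerivAt_id x).const_mul (A m)).add_const (B m * K)).add
      (hasDerivAt_logpoly (P m) K α x hK hx))
    have h2 : C m = (fun x => A m * id x + B m * K) +
        fun x => (P m).eval (Real.log (x / K)) * (x / K) ^ α := by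
      funext y; rw [hCP]; rfl
    rw [h2]
    exact h.congr_deriv (by simp [D])
  have hs0 : 0 < s := hK.trans hs
  have hd2 : HasDerivAt (deriv (C m))
      (((D (D (P m))).eval (Real.log (s / K)) - (D (P m)).eval (Real.log (s / K)))
        * (s / K) ^ α / s ^ 2) s := by
    have h := ((hasDerivAt_logpoly (D (P m)) K α s hK hs0).div (hasDerivAt_id s) hs0.ne').const_add
      (A m)
    have h' := h.congr_of_eventuallyEq (f₁ := deriv (C m)) (by
      filter_upwards [lt_mem_nhds hs0] with x hx
      rw [(hd1 x hx).deriv]; rfl)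
    refine h'.congr_deriv ?_
    simp only [D, id]
    field_simp
  refine ⟨(hd1 s hs0).differentiableAt, hd2.differentiableAt, ?_⟩
  have hpoly : Polynomial.C c * Polynomial.derivative (P m)
      + Polynomial.C a₂ * Polynomial.derivative (Polynomial.derivative (P m))
      + Polynomial.C lam * ∑ z ∈ Finset.Icc 1 (m - 1), Polynomial.C (p m z) * P (m - z) = 0 := by
    ext k
    simp only [Polynomial.coeff_add, Polynomial.coeff_C_mul, Polynomial.coeff_derivative,
      Polynomial.finset_sum_coeff, Polynomial.coeff_zero, hPc]
    have hsum : ∑ z ∈ Finset.Icc 1 (m - 1), p m z * (if k < m - z then E (m - z) k else 0)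
        = ∑ z ∈ Finset.Icc 1 (m - (k + 1)), p m z * E (m - z) k := by
      symm
      refine Finset.sum_subset_zero_on_sdiff ?_ ?_ ?_
      · intro z hz
        simp only [Finset.mem_Icc] at hz ⊢
        omega
      · intro z hz
        simp only [Finset.mem_sdiff, Finset.mem_Icc] at hz
        rw [if_neg (by omega), mul_zero]
      · intro z hz
        simp only [Finset.mem_Icc] at hz
        rw [if_pos (by omega)]
    rw [hsum]
    rcases lt_trichotomy (k + 2) m with h | h | h
    · have he := hEmid m (by omega) hmM (k + 1) (by omega) (by omega)
      have hk : ((k + 1 : ℕ) : ℝ) ≠ 0 := by positivity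
      rw [if_pos (by omega), if_pos (by omega), he]
      simp only [Nat.add_sub_cancel]
      push_cast at hk ⊢
      field_simp
      ring
    · have he := hEtop m (by omega) hmM
      subst h
      have hk : ((k + 1 : ℕ) : ℝ) ≠ 0 := by positivity
      rw [if_pos (by omega), if_neg (by omega)]
      have e1 : k + 2 - (k + 1) = 1 := by omega
      have e2 : k + 2 - 1 = k + 1 := by omega
      have e3 : k + 2 - 2 = k := by omega
      have e4 : ((k + 2 : ℕ) : ℝ) - 1 = k + 1 := by push_cast; ring
      rw [e2, e3, e4] at he
      rw [e1, Finset.Icc_self, Finset.sum_singleton, e2, he]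
      push_cast at hk ⊢
      field_simp
      ring
    · rw [if_neg (by omega), if_neg (by omega), Finset.Icc_eq_empty (by omega)]
      simp
  have hev := congrArg (Polynomial.eval (Real.log (s / K))) hpoly
  have hAm := hA m hm1 hmM
  have hBm := hB m hm1 hmM
  rw [eq_div_iff ha₁₀] at hAm
  rw [eq_div_iff ha₀0] at hBm
  have hsumC : ∑ z ∈ Finset.Icc 1 (m - 1), p m z * C (m - z) s
      = (∑ z ∈ Finset.Icc 1 (m - 1), p m z * A (m - z)) * s
        + (∑ z ∈ Finset.Icc 1 (m - 1), p m z * B (m - z)) * K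
        + (∑ z ∈ Finset.Icc 1 (m - 1), p m z * (P (m - z)).eval (Real.log (s / K)))
          * (s / K) ^ α := by
    simp only [Finset.sum_mul, ← Finset.sum_add_distrib]
    refine Finset.sum_congr rfl fun z _ => ?_
    rw [hCP]; ring
  rw [hsumC, hd2.deriv, (hd1 s hs0).deriv, hCP]
  simp only [D, Polynomial.eval_add, Polynomial.eval_mul, Polynomial.eval_C,
    Polynomial.eval_finset_sum, Polynomial.eval_zero, Polynomial.derivative_add,
    Polynomial.derivative_mul, Polynomial.derivative_C, zero_mul, zero_add] at hev ⊢
  generalize (s / K) ^ α = w at *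
  generalize (∑ z ∈ Finset.Icc 1 (m - 1), p m z * (P (m - z)).eval (Real.log (s / K))) = S at *
  generalize (∑ z ∈ Finset.Icc 1 (m - 1), p m z * A (m - z)) = SA at *
  generalize (∑ z ∈ Finset.Icc 1 (m - 1), p m z * B (m - z)) = SB at *
  generalize Polynomial.eval (Real.log (s / K)) (P m) = u0 at *
  generalize Polynomial.eval (Real.log (s / K)) (Polynomial.derivative (P m)) = u1 at *
  generalize Polynomial.eval (Real.log (s / K))
    (Polynomial.derivative (Polynomial.derivative (P m))) = u2 at *
  rw [← hcc] at hev
  field_simp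
  linear_combination w * hev + s * hAm + K * hBm + u0 * w * hchar
end

section
/- Let the coefficients F_{m,n} (1 ≤ m ≤ M, 0 ≤ n ≤ m−1) be defined by the Proposition's recursions, and for each m define C⁽ᵐ⁾(s) = Σ_{n=0}^{m−1} F_{m,n}(ln(s/K))ⁿ(s/K)^{γ+θ} for 0 < s ≤ K. Then for every 1 ≤ m ≤ M, C⁽ᵐ⁾ is twice differentiable on (0,K) and satisfies, for all 0 < s < K, a₀C⁽ᵐ⁾(s) + a₁s(C⁽ᵐ⁾)′(s) + a₂s²(C⁽ᵐ⁾)″(s) + λ·Σ_{z=1}^{m−1} p_{m,z}C⁽ᵐ⁻ᶻ⁾(s) = 0 (the source term g_m(s−K)⁺ vanishing for s ≤ K). -/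
open Polynomial in
/-- Derivative of a polynomial in `log (s/K)` times a power. -/
lemma aux_deriv (P : ℝ[X]) (K μ s : ℝ) (hK : 0 < K) (hs : 0 < s) :
    HasDerivAt (fun s : ℝ => P.eval (Real.log (s / K)) * (s / K) ^ μ)
      ((derivative P + C μ * P).eval (Real.log (s / K)) * (s / K) ^ μ / s) s := by
  have hsK : 0 < s / K := div_pos hs hK
  have h1 : HasDerivAt (fun s : ℝ => s / K) (1 / K) s := (hasDerivAt_id s).div_const K
  have h2 := h1.log hsK.ne'
  have h3 := (P.hasDerivAt (Real.log (s / K))).comp s h2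
  have h4 := h1.rpow_const (p := μ) (Or.inl hsK.ne')
  have h5 := h3.mul h4
  refine h5.congr_deriv ?_
  have e : (s / K) ^ (μ - 1) = (s / K) ^ μ / (s / K) := Real.rpow_sub_one hsK.ne' μ
  simp only [Function.comp, eval_add, eval_mul, eval_C, e]
  field_simp

open Polynomial in
/-- The log-polynomial. -/
noncomputable def auxP (F : ℕ → ℕ → ℝ) (m : ℕ) : ℝ[X] :=
  ∑ n ∈ Finset.range m, C (F m n) * X ^ n

lemma auxP_coeff (F : ℕ → ℕ → ℝ) (m n : ℕ) :
    (auxP F m).coeff n = if n < m then F m n else 0 := by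
  simp [auxP, Polynomial.coeff_C_mul, Polynomial.coeff_X_pow]

lemma auxP_eval (F : ℕ → ℕ → ℝ) (m : ℕ) (x : ℝ) :
    (auxP F m).eval x = ∑ n ∈ Finset.range m, F m n * x ^ n := by
  simp [auxP, Polynomial.eval_finsetSum]

open Polynomial in
lemma auxP_ode (F : ℕ → ℕ → ℝ) (p : ℕ → ℕ → ℝ) (lam a₂ D : ℝ) (m : ℕ)
    (h : ∀ n, n + 1 < m → lam * ∑ z ∈ Finset.Icc 1 (m - (n + 1)), p m z * F (m - z) n
      + ((n : ℝ) + 2) * ((n : ℝ) + 1) * a₂ * (if n + 2 < m then F m (n + 2) else 0)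
      + ((n : ℝ) + 1) * D * F m (n + 1) = 0) :
    C a₂ * derivative (derivative (auxP F m)) + C D * derivative (auxP F m)
      + C lam * ∑ z ∈ Finset.Icc 1 (m - 1), C (p m z) * auxP F (m - z) = 0 := by
  ext n
  simp only [coeff_add, coeff_C_mul, coeff_derivative, finsetSum_coeff, auxP_coeff, coeff_zero]
  have hsum : ∑ z ∈ Finset.Icc 1 (m - 1), p m z * (if n < m - z then F (m - z) n else 0)
      = ∑ z ∈ Finset.Icc 1 (m - (n + 1)), p m z * F (m - z) n := by
    symm
    apply Finset.sum_subset_zero_on_sdiff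
    · intro z hz
      simp only [Finset.mem_Icc] at hz ⊢
      omega
    · intro z hz
      simp only [Finset.mem_sdiff, Finset.mem_Icc] at hz
      rw [if_neg (by omega), mul_zero]
    · intro z hz
      simp only [Finset.mem_Icc] at hz
      rw [if_pos (by omega)]
  rw [hsum]
  by_cases hn : n + 1 < m
  · have h' := h n hn
    rw [if_pos hn]
    push_cast
    simp only [show n + 1 + 1 = n + 2 from rfl]
    linear_combination h'
  · rw [if_neg hn, if_neg (by omega), show m - (n + 1) = 0 by omega]
    simp

/-- With the coefficients F_{m,n} (and companion A_m, B_m, E_{m,n}) defined by the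
Proposition's recursions, the below-strike piece
C⁽ᵐ⁾(s) = Σ_{n=0}^{m−1} F_{m,n}(ln(s/K))ⁿ(s/K)^{γ+θ}
is twice differentiable on (0,K) and satisfies there
a₀C⁽ᵐ⁾ + a₁sC⁽ᵐ⁾′ + a₂s²C⁽ᵐ⁾″ + λΣ_{z=1}^{m−1}p_{m,z}C⁽ᵐ⁻ᶻ⁾ = 0
(the source term g_m(s−K)⁺ vanishing for s ≤ K). -/
theorem stmt_7 (r q σ lam β κ K : ℝ)
    (hr : 0 < r) (hq : 0 ≤ q) (hσ : 0 < σ) (hlam : 0 ≤ lam) (hβ : 0 ≤ β)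
    (hκ : 0 < κ) (hK : 0 < K)
    (a₀ a₁ a₂ γ θ : ℝ)
    (ha₀ : a₀ = -(r + lam + β + κ)) (ha₁ : a₁ = r - q) (ha₂ : a₂ = σ ^ 2 / 2)
    (hγ : γ = 1 / 2 - (r - q) / σ ^ 2)
    (hθ : θ = Real.sqrt (γ ^ 2 + 2 * (r + lam + β + κ) / σ ^ 2))
    (M : ℕ) (hM : 1 ≤ M)
    (p : ℕ → ℕ → ℝ)
    (hp_nonneg : ∀ m z, 1 ≤ m → m ≤ M → 1 ≤ z → z ≤ m → 0 ≤ p m z)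
    (hp_sum : ∀ m, 1 ≤ m → m ≤ M → ∑ z ∈ Finset.Icc 1 m, p m z = 1)
    (pbar g : ℕ → ℝ)
    (hpbar : ∀ m, pbar m = ∑ z ∈ Finset.Icc 1 m, (z : ℝ) * p m z)
    (hg : ∀ m, g m = lam * pbar m + (m : ℝ) * (β + κ))
    (A B : ℕ → ℝ) (E F : ℕ → ℕ → ℝ)
    (hA : ∀ m, 1 ≤ m → m ≤ M →
      A m = (-lam * ∑ z ∈ Finset.Icc 1 (m - 1), p m z * A (m - z) - g m) / (a₁ + a₀))
    (hB : ∀ m, 1 ≤ m → m ≤ M →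
      B m = (-lam * ∑ z ∈ Finset.Icc 1 (m - 1), p m z * B (m - z) + g m) / a₀)
    (hE₁₀ : E 1 0 = -(((γ + θ) * (A 1 + B 1) * K - A 1 * K) / (2 * θ)))
    (hF₁₀ : F 1 0 = -(((γ - θ) * (A 1 + B 1) * K - A 1 * K) / (2 * θ)))
    (hEtop : ∀ m, 2 ≤ m → m ≤ M →
      E m (m - 1) = -(lam * p m 1 * E (m - 1) (m - 2))
        / (((m : ℝ) - 1) * (a₁ + 2 * a₂ * (γ - θ) - a₂)))
    (hFtop : ∀ m, 2 ≤ m → m ≤ M →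
      F m (m - 1) = -(lam * p m 1 * F (m - 1) (m - 2))
        / (((m : ℝ) - 1) * (a₁ + 2 * a₂ * (γ + θ) - a₂)))
    (hEmid : ∀ m, 2 ≤ m → m ≤ M → ∀ n, 1 ≤ n → n ≤ m - 2 →
      E m n = -((lam * ∑ z ∈ Finset.Icc 1 (m - n), p m z * E (m - z) (n - 1)
          + ((n : ℝ) + 1) * (n : ℝ) * a₂ * E m (n + 1))
        / ((n : ℝ) * (a₁ + 2 * a₂ * (γ - θ) - a₂))))
    (hFmid : ∀ m, 2 ≤ m → m ≤ M → ∀ n, 1 ≤ n → n ≤ m - 2 →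
      F m n = -((lam * ∑ z ∈ Finset.Icc 1 (m - n), p m z * F (m - z) (n - 1)
          + ((n : ℝ) + 1) * (n : ℝ) * a₂ * F m (n + 1))
        / ((n : ℝ) * (a₁ + 2 * a₂ * (γ + θ) - a₂))))
    (hE₀ : ∀ m, 2 ≤ m → m ≤ M →
      E m 0 = -(((A m + B m) * K * (γ + θ) - A m * K + F m 1 - E m 1) / (2 * θ)))
    (hF₀ : ∀ m, 2 ≤ m → m ≤ M →
      F m 0 = -(((A m + B m) * K * (γ - θ) - A m * K + F m 1 - E m 1) / (2 * θ)))
    (C : ℕ → ℝ → ℝ)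
    (hC : ∀ m s, C m s =
      ∑ n ∈ Finset.range m, F m n * (Real.log (s / K)) ^ n * (s / K) ^ (γ + θ)) :
    ∀ m, 1 ≤ m → m ≤ M → ∀ s : ℝ, 0 < s → s < K →
      DifferentiableAt ℝ (C m) s ∧ DifferentiableAt ℝ (deriv (C m)) s ∧
      a₀ * C m s + a₁ * s * deriv (C m) s + a₂ * s ^ 2 * deriv (deriv (C m)) s
        + lam * ∑ z ∈ Finset.Icc 1 (m - 1), p m z * C (m - z) s = 0 := by
  intro m hm1 hmM s hs hsK
  set μ := γ + θ with hμ
  set D := a₁ + 2 * a₂ * μ - a₂ with hD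
  have hσ2 : 0 < σ ^ 2 := by positivity
  have hrad : 0 < γ ^ 2 + 2 * (r + lam + β + κ) / σ ^ 2 := by positivity
  have hθpos : 0 < θ := by rw [hθ]; exact Real.sqrt_pos.mpr hrad
  have hθ2 : θ ^ 2 = γ ^ 2 + 2 * (r + lam + β + κ) / σ ^ 2 := by
    rw [hθ]; exact Real.sq_sqrt hrad.le
  have hγ' : σ ^ 2 * γ = σ ^ 2 / 2 - (r - q) := by rw [hγ]; field_simp
  have hθ2' : σ ^ 2 * θ ^ 2 = σ ^ 2 * γ ^ 2 + 2 * (r + lam + β + κ) := by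
    rw [hθ2]; field_simp
  have hDval : D = σ ^ 2 * θ := by
    rw [hD, hμ, ha₁, ha₂]; linear_combination hγ'
  have hD0 : D ≠ 0 := by rw [hDval]; positivity
  have hchar : a₀ + a₁ * μ + a₂ * (μ ^ 2 - μ) = 0 := by
    rw [hμ, ha₀, ha₁, ha₂]; linear_combination (γ + θ) * hγ' + hθ2' / 2
  have hode := auxP_ode F p lam a₂ D m (by
    intro n hn
    have hn1 : ((n : ℝ) + 1) ≠ 0 := by positivity
    by_cases hn2 : n + 2 < m
    · have := hFmid m (by omega) hmM (n + 1) (by omega) (by omega)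
      rw [if_pos hn2, this]
      push_cast
      simp only [Nat.add_sub_cancel, show n + 1 + 1 = n + 2 from rfl]
      field_simp
      ring
    · obtain rfl : m = n + 2 := by omega
      have := hFtop (n + 2) (by omega) hmM
      simp only [show n + 2 - 1 = n + 1 from rfl, show n + 2 - 2 = n from rfl] at this
      rw [if_neg hn2, this, show n + 2 - (n + 1) = 1 by omega]
      simp only [Finset.Icc_self, Finset.sum_singleton, show n + 2 - 1 = n + 1 from rfl]
      push_cast
      have e : (n : ℝ) + 2 - 1 = n + 1 := by ring
      rw [e]
      field_simp
      ring)
  have hCP : ∀ k, C k = fun s => (auxP F k).eval (Real.log (s / K)) * (s / K) ^ μ := by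
    intro k
    funext t
    rw [hC, auxP_eval, Finset.sum_mul]
  set Q := Polynomial.derivative (auxP F m) + Polynomial.C μ * auxP F m with hQ
  have hd1 : ∀ t, 0 < t → HasDerivAt (C m)
      (Q.eval (Real.log (t / K)) * (t / K) ^ μ / t) t := by
    intro t ht
    rw [hCP]
    exact aux_deriv _ K μ t hK ht
  have hev : deriv (C m) =ᶠ[nhds s] fun t => Q.eval (Real.log (t / K)) * (t / K) ^ μ / t := by
    filter_upwards [lt_mem_nhds hs] with t ht
    exact (hd1 t ht).deriv
  have hd2 := ((aux_deriv Q K μ s hK hs).div (hasDerivAt_id s) hs.ne').congr_of_eventuallyEq hev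
  refine ⟨(hd1 s hs).differentiableAt, hd2.differentiableAt, ?_⟩
  rw [hd2.deriv, (hd1 s hs).deriv]
  have hev2 := congrArg (Polynomial.eval (Real.log (s / K))) hode
  simp only [hCP]
  simp only [hQ, Polynomial.eval_add, Polynomial.eval_mul, Polynomial.eval_C,
    Polynomial.eval_finsetSum, Polynomial.eval_zero, Polynomial.derivative_add,
    Polynomial.derivative_mul, Polynomial.derivative_C, id] at hev2 ⊢
  have hS : ∑ z ∈ Finset.Icc 1 (m - 1), p m z *
      ((auxP F (m - z)).eval (Real.log (s / K)) * (s / K) ^ μ)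
      = (∑ z ∈ Finset.Icc 1 (m - 1), p m z * (auxP F (m - z)).eval (Real.log (s / K)))
        * (s / K) ^ μ := by
    rw [Finset.sum_mul]
    exact Finset.sum_congr rfl fun z _ => by ring
  rw [hS]
  generalize (s / K) ^ μ = W at *
  generalize (∑ z ∈ Finset.Icc 1 (m - 1), p m z * (auxP F (m - z)).eval (Real.log (s / K)))
    = S at *
  generalize (auxP F m).eval (Real.log (s / K)) = P0 at *
  generalize (Polynomial.derivative (auxP F m)).eval (Real.log (s / K)) = P1 at *
  generalize (Polynomial.derivative (Polynomial.derivative (auxP F m))).eval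
    (Real.log (s / K)) = P2 at *
  rw [hD] at hev2
  field_simp
  linear_combination W * hev2 + W * P0 * hchar
end

section
/- Assume additionally α ≥ 0, κ̃ > 0, q+α+κ̃ ≠ 0, r+α+κ̃ ≠ 0 and R := λ+β+κ−α−κ̃ ≠ 0, and set θ̃ = √(γ² + 2(r+α+κ̃)/σ²), γ̃ = γ. Let (A_m, B_m, E_{m,n}, F_{m,n}) and the vested values C⁽ᵐ⁾ be as in the Proposition, and define: Ã_m = κ̃A_m/(q+α+κ̃), B̃_m = κ̃B_m/(r+α+κ̃), P₁ = r−q+σ²(2γ−2θ−1)/2, Q₁ = r−q+σ²(2γ+2θ−1)/2; Ẽ_{m,m−1} = −κ̃E_{m,m−1}/R, F̃_{m,m−1} = −κ̃F_{m,m−1}/R; for m ≥ 2, Ẽ_{m,m−2} = −(κ̃E_{m,m−2}+(m−1)P₁Ẽ_{m,m−1})/R and F̃_{m,m−2} = −(κ̃F_{m,m−2}+(m−1)Q₁F̃_{m,m−1})/R; for 0 ≤ n ≤ m−3, Ẽ_{m,n} = −(2κ̃E_{m,n}+2(n+1)P₁Ẽ_{m,n+1}+σ²(n+2)(n+1)Ẽ_{m,n+2})/(2R)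 and F̃_{m,n} = −(2κ̃F_{m,n}+2(n+1)Q₁F̃_{m,n+1}+σ²(n+2)(n+1)F̃_{m,n+2})/(2R); and Ẽ_m = ((γ̃+θ̃)P−Q)/(2θ̃), F̃_m = ((γ̃−θ̃)P−Q)/(2θ̃), where P = F̃_{m,0}−Ẽ_{m,0}−KÃ_m−KB̃_m and Q = (γ+θ)F̃_{m,0}−(γ−θ)Ẽ_{m,0}−KÃ_m+F̃_{m,1}−Ẽ_{m,1}. Define C̃⁽ᵐ⁾(s) = Ã_m s + B̃_m K + Σ_{n=0}^{m−1}Ẽ_{m,n}(ln(s/K))ⁿ(s/K)^{γ−θ} + Ẽ_m(s/K)^{γ̃−θ̃} for s > K and C̃⁽ᵐ⁾(s) = Σ_{n=0}^{m−1}F̃_{m,n}(ln(s/K))ⁿ(s/K)^{γ+θ} + F̃_m(s/K)^{γ̃+θ̃} for 0 < s ≤ K. Then for every 1 ≤ m ≤ M: (i) on (0,K) and on (K,∞), C̃⁽ᵐ⁾ is twice differentiable and −(r+α+κ̃)C̃⁽ᵐ⁾(s) + (r−q)s(C̃⁽ᵐ⁾)′(s) + (σ²s²/2)(C̃⁽ᵐ⁾)″(s)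 + κ̃C⁽ᵐ⁾(s) = 0; (ii) the one-sided limits at s = K of C̃⁽ᵐ⁾ and of its first derivative coincide. -/
open Filter Topology

noncomputable def SS (K : ℝ) (e : ℕ → ℝ) (m : ℕ) (μ : ℝ) (s : ℝ) : ℝ :=
  ∑ n ∈ Finset.range m, e n * (Real.log (s / K)) ^ n * (s / K) ^ μ

def TT (μ : ℝ) (e : ℕ → ℝ) (n : ℕ) : ℝ := μ * e n + ((n : ℝ) + 1) * e (n + 1)

lemma TT_zero (μ : ℝ) (e : ℕ → ℝ) (m : ℕ) (h : ∀ n, m ≤ n → e n = 0) :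
    ∀ n, m ≤ n → TT μ e n = 0 := by
  intro n hn
  simp [TT, h n hn, h (n + 1) (by omega)]

lemma SS_deriv (K : ℝ) (hK : 0 < K) (e : ℕ → ℝ) (m : ℕ) (μ : ℝ)
    (h : ∀ n, m ≤ n → e n = 0) (s : ℝ) (hs : 0 < s) :
    HasDerivAt (SS K e m μ) (SS K (TT μ e) m μ s / s) s := by
  have hx : 0 < s / K := div_pos hs hK
  have hlin : HasDerivAt (fun t : ℝ => t / K) (1 / K) s := (hasDerivAt_id s).div_const K
  have hlog : HasDerivAt (fun t : ℝ => Real.log (t / K)) (1 / s) s := by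
    have := hlin.log hx.ne'
    convert this using 1
    field_simp
  have hpow : HasDerivAt (fun t : ℝ => (t / K) ^ μ) (μ * (s / K) ^ μ / s) s := by
    have := hlin.rpow_const (p := μ) (Or.inl hx.ne')
    convert this using 1
    rw [Real.rpow_sub_one hx.ne']
    field_simp
  have hsum : HasDerivAt (fun t => ∑ n ∈ Finset.range m,
      e n * (Real.log (t / K)) ^ n * (t / K) ^ μ)
      (∑ n ∈ Finset.range m, (e n * ((n : ℝ) * (Real.log (s / K)) ^ (n - 1) * (1 / s)) * (s / K) ^ μ
        + e n * (Real.log (s / K)) ^ n * (μ * (s / K) ^ μ / s))) s := by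
    apply HasDerivAt.fun_sum
    intro n _
    exact ((hlog.pow n).const_mul (e n)).mul hpow
  change HasDerivAt (fun t => ∑ n ∈ Finset.range m,
      e n * (Real.log (t / K)) ^ n * (t / K) ^ μ) _ s
  convert hsum using 1
  have key : ∑ n ∈ Finset.range m, ((n : ℝ) + 1) * e (n + 1) * (Real.log (s / K)) ^ n
      = ∑ n ∈ Finset.range m, (n : ℝ) * e n * (Real.log (s / K)) ^ (n - 1) := by
    have h1 := Finset.sum_range_succ (fun n : ℕ => (n : ℝ) * e n * (Real.log (s / K)) ^ (n - 1)) m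
    have h2 := Finset.sum_range_succ' (fun n : ℕ => (n : ℝ) * e n * (Real.log (s / K)) ^ (n - 1)) m
    rw [h1] at h2
    simp [h m le_rfl] at h2
    exact h2.symm
  have e1 : SS K (TT μ e) m μ s / s = (∑ n ∈ Finset.range m, ((n : ℝ) + 1) * e (n + 1) * (Real.log (s / K)) ^ n) * ((s / K) ^ μ / s)
      + ∑ n ∈ Finset.range m, e n * (Real.log (s / K)) ^ n * (μ * (s / K) ^ μ / s) := by
    rw [SS, Finset.sum_div, Finset.sum_mul, ← Finset.sum_add_distrib]
    refine Finset.sum_congr rfl fun n _ => ?_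
    simp only [TT]; ring
  rw [e1, key, Finset.sum_mul, ← Finset.sum_add_distrib]
  refine Finset.sum_congr rfl fun n _ => ?_
  ring

lemma SS_at (K : ℝ) (hK : 0 < K) (e : ℕ → ℝ) (m : ℕ) (hm : 1 ≤ m) (μ : ℝ) :
    SS K e m μ K = e 0 := by
  obtain ⟨k, rfl⟩ : ∃ k, m = k + 1 := ⟨m - 1, by omega⟩
  simp [SS, div_self hK.ne', Finset.sum_range_succ']

noncomputable def GG (K a b : ℝ) (e : ℕ → ℝ) (m : ℕ) (μ : ℝ) (d : ℕ → ℝ) (ν : ℝ) (s : ℝ) : ℝ :=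
  a * s + b + SS K e m μ s + SS K d 1 ν s

noncomputable def GG1 (K a : ℝ) (e : ℕ → ℝ) (m : ℕ) (μ : ℝ) (d : ℕ → ℝ) (ν : ℝ) (s : ℝ) : ℝ :=
  a + SS K (TT μ e) m μ s / s + SS K (TT ν d) 1 ν s / s

lemma GG_deriv (K a b : ℝ) (hK : 0 < K) (e : ℕ → ℝ) (m : ℕ) (μ : ℝ) (d : ℕ → ℝ) (ν : ℝ)
    (h : ∀ n, m ≤ n → e n = 0) (hd : ∀ n, 1 ≤ n → d n = 0) (s : ℝ) (hs : 0 < s) :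
    HasDerivAt (GG K a b e m μ d ν) (GG1 K a e m μ d ν s) s := by
  have := ((((hasDerivAt_id s).const_mul a).add_const b).add
    (SS_deriv K hK e m μ h s hs)).add (SS_deriv K hK d 1 ν hd s hs)
  refine HasDerivAt.congr_deriv this ?_
  simp [GG1]

lemma GG1_deriv (K a : ℝ) (hK : 0 < K) (e : ℕ → ℝ) (m : ℕ) (μ : ℝ) (d : ℕ → ℝ) (ν : ℝ)
    (h : ∀ n, m ≤ n → e n = 0) (hd : ∀ n, 1 ≤ n → d n = 0) (s : ℝ) (hs : 0 < s) :
    HasDerivAt (GG1 K a e m μ d ν)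
      ((SS K (TT μ (TT μ e)) m μ s - SS K (TT μ e) m μ s) / s ^ 2
        + (SS K (TT ν (TT ν d)) 1 ν s - SS K (TT ν d) 1 ν s) / s ^ 2) s := by
  have h1 := (SS_deriv K hK _ m μ (TT_zero μ e m h) s hs).div (hasDerivAt_id s) hs.ne'
  have h2 := (SS_deriv K hK _ 1 ν (TT_zero ν d 1 hd) s hs).div (hasDerivAt_id s) hs.ne'
  have := (h1.const_add a).add h2
  refine HasDerivAt.congr_deriv this ?_
  simp only [id]; field_simp

lemma GG_ode (K a b ρ a1 a2 k a' b' : ℝ) (hK : 0 < K) (e E : ℕ → ℝ) (m : ℕ) (μ : ℝ) (d : ℕ → ℝ) (ν : ℝ)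
    (h : ∀ n, m ≤ n → e n = 0) (hd : ∀ n, 1 ≤ n → d n = 0) (U : Set ℝ) (hU : IsOpen U)
    (hpos : ∀ s ∈ U, 0 < s) (f C : ℝ → ℝ) (hf : ∀ s ∈ U, f s = GG K a b e m μ d ν s)
    (hC : ∀ s ∈ U, C s = a' * s + b' + SS K E m μ s)
    (ha : -ρ * a + a1 * a + k * a' = 0) (hb : -ρ * b + k * b' = 0)
    (hν : a2 * ν ^ 2 + (a1 - a2) * ν = ρ)
    (he : ∀ n, n < m → (a2 * μ ^ 2 + (a1 - a2) * μ - ρ) * e n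
      + ((n : ℝ) + 1) * (2 * a2 * μ + a1 - a2) * e (n + 1)
      + a2 * ((n : ℝ) + 2) * ((n : ℝ) + 1) * e (n + 2) + k * E n = 0)
    (s : ℝ) (hs : s ∈ U) :
    DifferentiableAt ℝ f s ∧ DifferentiableAt ℝ (deriv f) s ∧
      -ρ * f s + a1 * s * deriv f s + a2 * s ^ 2 * deriv (deriv f) s + k * C s = 0 := by
  have hnear : ∀ t ∈ U, f =ᶠ[𝓝 t] GG K a b e m μ d ν := fun t ht =>
    Filter.eventually_of_mem (hU.mem_nhds ht) hf
  have hd1 : ∀ t ∈ U, HasDerivAt f (GG1 K a e m μ d ν t) t := fun t ht =>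
    (GG_deriv K a b hK e m μ d ν h hd t (hpos t ht)).congr_of_eventuallyEq (hnear t ht)
  have hd2 := (GG1_deriv K a hK e m μ d ν h hd s (hpos s hs)).congr_of_eventuallyEq
    (f₁ := deriv f) (Filter.eventually_of_mem (hU.mem_nhds hs) fun t ht => (hd1 t ht).deriv)
  refine ⟨(hd1 s hs).differentiableAt, hd2.differentiableAt, ?_⟩
  have hs0 := (hpos s hs).ne'
  rw [hd2.deriv, (hd1 s hs).deriv, hf s hs, hC s hs]
  have k1 : -ρ * SS K e m μ s + a1 * SS K (TT μ e) m μ s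
      + a2 * (SS K (TT μ (TT μ e)) m μ s - SS K (TT μ e) m μ s) + k * SS K E m μ s = 0 := by
    simp only [SS, ← Finset.sum_sub_distrib, Finset.mul_sum, ← Finset.sum_add_distrib]
    refine Finset.sum_eq_zero fun n hn => ?_
    have := he n (Finset.mem_range.mp hn)
    simp only [TT]
    push_cast
    linear_combination (Real.log (s / K)) ^ n * (s / K) ^ μ * this
  have k2 : -ρ * SS K d 1 ν s + a1 * SS K (TT ν d) 1 ν s
      + a2 * (SS K (TT ν (TT ν d)) 1 ν s - SS K (TT ν d) 1 ν s) = 0 := by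
    simp [SS, TT, hd]
    linear_combination d 0 * (s / K) ^ ν * hν
  have r1 : ∀ x : ℝ, s * (x / s) = x := fun x => by field_simp
  have r2 : ∀ x : ℝ, s ^ 2 * (x / s ^ 2) = x := fun x => by field_simp
  simp only [GG, GG1]
  have r1a := r1 (SS K (TT μ e) m μ s)
  have r1b := r1 (SS K (TT ν d) 1 ν s)
  have r2a := r2 (SS K (TT μ (TT μ e)) m μ s - SS K (TT μ e) m μ s)
  have r2b := r2 (SS K (TT ν (TT ν d)) 1 ν s - SS K (TT ν d) 1 ν s)
  linear_combination s * ha + hb + k1 + k2 + a1 * r1a + a1 * r1b + a2 * r2a + a2 * r2b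

lemma GG_lim (K a b : ℝ) (hK : 0 < K) (e : ℕ → ℝ) (m : ℕ) (hm : 1 ≤ m) (μ : ℝ) (d : ℕ → ℝ) (ν : ℝ)
    (h : ∀ n, m ≤ n → e n = 0) (hd : ∀ n, 1 ≤ n → d n = 0) (U V : Set ℝ) (hU : IsOpen U)
    (hpos : ∀ s ∈ U, 0 < s) (f : ℝ → ℝ) (hf : ∀ s ∈ U, f s = GG K a b e m μ d ν s)
    (hUV : U ∈ 𝓝[V] K) :
    Tendsto f (𝓝[V] K) (𝓝 (a * K + b + e 0 + d 0)) ∧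
    Tendsto (deriv f) (𝓝[V] K) (𝓝 (a + (μ * e 0 + e 1) / K + (ν * d 0) / K)) := by
  have hd1 : ∀ t ∈ U, deriv f t = GG1 K a e m μ d ν t := fun t ht =>
    ((GG_deriv K a b hK e m μ d ν h hd t (hpos t ht)).congr_of_eventuallyEq
      (Filter.eventually_of_mem (hU.mem_nhds ht) hf)).deriv
  have v0 : GG K a b e m μ d ν K = a * K + b + e 0 + d 0 := by
    simp [GG, SS_at K hK, hm]
  have v1 : GG1 K a e m μ d ν K = a + (μ * e 0 + e 1) / K + (ν * d 0) / K := by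
    simp [GG1, SS_at K hK, hm, TT, hd]
  rw [← v0, ← v1]
  constructor
  · refine Tendsto.congr' ?_ ((GG_deriv K a b hK e m μ d ν h hd K hK).continuousAt.tendsto.mono_left
      nhdsWithin_le_nhds)
    exact Filter.eventually_of_mem hUV fun t ht => (hf t ht).symm
  · refine Tendsto.congr' ?_ ((GG1_deriv K a hK e m μ d ν h hd K hK).continuousAt.tendsto.mono_left
      nhdsWithin_le_nhds)
    exact Filter.eventually_of_mem hUV fun t ht => (hd1 t ht).symm

lemma rec_unify (m : ℕ) (hm : 1 ≤ m) (R k P σ : ℝ) (hR : R ≠ 0) (E e : ℕ → ℝ)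
    (h : ∀ n, m ≤ n → e n = 0)
    (htop : e (m - 1) = -(k * E (m - 1)) / R)
    (hsub : 2 ≤ m → e (m - 2) = -(k * E (m - 2) + ((m : ℝ) - 1) * P * e (m - 1)) / R)
    (hlow : ∀ n, n + 3 ≤ m → e n = -(2 * k * E n + 2 * ((n : ℝ) + 1) * P * e (n + 1)
        + σ ^ 2 * ((n : ℝ) + 2) * ((n : ℝ) + 1) * e (n + 2)) / (2 * R)) :
    ∀ n, n < m → R * e n + ((n : ℝ) + 1) * P * e (n + 1)
      + σ ^ 2 / 2 * ((n : ℝ) + 2) * ((n : ℝ) + 1) * e (n + 2) + k * E n = 0 := by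
  intro n hn
  rcases (by omega : n + 1 = m ∨ n + 2 = m ∨ n + 3 ≤ m) with h1 | h1 | h1
  · subst h1
    rw [h (n + 1) le_rfl, h (n + 2) (by omega)]
    simp only [Nat.add_sub_cancel] at htop
    rw [htop]; field_simp; ring
  · subst h1
    rw [h (n + 2) le_rfl]
    have := hsub (by omega)
    rw [show n + 2 - 1 = n + 1 by omega, show n + 2 - 2 = n by omega] at this
    push_cast at this
    rw [this]; field_simp; ring
  · rw [hlow n h1]; field_simp; ring


/-- With the vested coefficients (A_m, B_m, E_{m,n}, F_{m,n}) and vested values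
C⁽ᵐ⁾ as in the Proposition, and the unvested (tilde) coefficients defined by the stated
recursions (with R = λ+β+κ−α−κ̃ ≠ 0, θ̃ = √(γ²+2(r+α+κ̃)/σ²), γ̃ = γ), the unvested value C̃⁽ᵐ⁾
(i) is twice differentiable on (0,K) and (K,∞) and satisfies
−(r+α+κ̃)C̃⁽ᵐ⁾ + (r−q)sC̃⁽ᵐ⁾′ + (σ²s²/2)C̃⁽ᵐ⁾″ + κ̃C⁽ᵐ⁾ = 0 there, and
(ii) has matching one-sided limits of value and first derivative at s = K. -/
theorem stmt_11 (r q σ lam β κ K : ℝ)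
    (hr : 0 < r) (hq : 0 ≤ q) (hσ : 0 < σ) (hlam : 0 ≤ lam) (hβ : 0 ≤ β)
    (hκ : 0 < κ) (hK : 0 < K)
    (a₀ a₁ a₂ γ θ : ℝ)
    (ha₀ : a₀ = -(r + lam + β + κ)) (ha₁ : a₁ = r - q) (ha₂ : a₂ = σ ^ 2 / 2)
    (hγ : γ = 1 / 2 - (r - q) / σ ^ 2)
    (hθ : θ = Real.sqrt (γ ^ 2 + 2 * (r + lam + β + κ) / σ ^ 2))
    (M : ℕ) (hM : 1 ≤ M)
    (p : ℕ → ℕ → ℝ)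
    (hp_nonneg : ∀ m z, 1 ≤ m → m ≤ M → 1 ≤ z → z ≤ m → 0 ≤ p m z)
    (hp_sum : ∀ m, 1 ≤ m → m ≤ M → ∑ z ∈ Finset.Icc 1 m, p m z = 1)
    (pbar g : ℕ → ℝ)
    (hpbar : ∀ m, pbar m = ∑ z ∈ Finset.Icc 1 m, (z : ℝ) * p m z)
    (hg : ∀ m, g m = lam * pbar m + (m : ℝ) * (β + κ))
    -- the Proposition's (vested) coefficients
    (A B : ℕ → ℝ) (E F : ℕ → ℕ → ℝ)
    (hA : ∀ m, 1 ≤ m → m ≤ M →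
      A m = (-lam * ∑ z ∈ Finset.Icc 1 (m - 1), p m z * A (m - z) - g m) / (a₁ + a₀))
    (hB : ∀ m, 1 ≤ m → m ≤ M →
      B m = (-lam * ∑ z ∈ Finset.Icc 1 (m - 1), p m z * B (m - z) + g m) / a₀)
    (hE₁₀ : E 1 0 = -(((γ + θ) * (A 1 + B 1) * K - A 1 * K) / (2 * θ)))
    (hF₁₀ : F 1 0 = -(((γ - θ) * (A 1 + B 1) * K - A 1 * K) / (2 * θ)))
    (hEtop : ∀ m, 2 ≤ m → m ≤ M →
      E m (m - 1) = -(lam * p m 1 * E (m - 1) (m - 2))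
        / (((m : ℝ) - 1) * (a₁ + 2 * a₂ * (γ - θ) - a₂)))
    (hFtop : ∀ m, 2 ≤ m → m ≤ M →
      F m (m - 1) = -(lam * p m 1 * F (m - 1) (m - 2))
        / (((m : ℝ) - 1) * (a₁ + 2 * a₂ * (γ + θ) - a₂)))
    (hEmid : ∀ m, 2 ≤ m → m ≤ M → ∀ n, 1 ≤ n → n ≤ m - 2 →
      E m n = -((lam * ∑ z ∈ Finset.Icc 1 (m - n), p m z * E (m - z) (n - 1)
          + ((n : ℝ) + 1) * (n : ℝ) * a₂ * E m (n + 1))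
        / ((n : ℝ) * (a₁ + 2 * a₂ * (γ - θ) - a₂))))
    (hFmid : ∀ m, 2 ≤ m → m ≤ M → ∀ n, 1 ≤ n → n ≤ m - 2 →
      F m n = -((lam * ∑ z ∈ Finset.Icc 1 (m - n), p m z * F (m - z) (n - 1)
          + ((n : ℝ) + 1) * (n : ℝ) * a₂ * F m (n + 1))
        / ((n : ℝ) * (a₁ + 2 * a₂ * (γ + θ) - a₂))))
    (hE₀ : ∀ m, 2 ≤ m → m ≤ M →
      E m 0 = -(((A m + B m) * K * (γ + θ) - A m * K + F m 1 - E m 1) / (2 * θ)))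
    (hF₀ : ∀ m, 2 ≤ m → m ≤ M →
      F m 0 = -(((A m + B m) * K * (γ - θ) - A m * K + F m 1 - E m 1) / (2 * θ)))
    -- the vested value of the Proposition
    (C : ℕ → ℝ → ℝ)
    (hC : ∀ m s, C m s =
      if K < s then
        A m * s + B m * K
          + ∑ n ∈ Finset.range m, E m n * (Real.log (s / K)) ^ n * (s / K) ^ (γ - θ)
      else ∑ n ∈ Finset.range m, F m n * (Real.log (s / K)) ^ n * (s / K) ^ (γ + θ))
    -- additional constants for the unvested problem
    (α κt : ℝ) (hα : 0 ≤ α) (hκt : 0 < κt)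
    (hqκ : q + α + κt ≠ 0) (hrκ : r + α + κt ≠ 0)
    (R : ℝ) (hR_def : R = lam + β + κ - α - κt) (hR : R ≠ 0)
    (θt γt : ℝ) (hθt : θt = Real.sqrt (γ ^ 2 + 2 * (r + α + κt) / σ ^ 2)) (hγt : γt = γ)
    (P₁ Q₁ : ℝ)
    (hP₁ : P₁ = r - q + σ ^ 2 * (2 * γ - 2 * θ - 1) / 2)
    (hQ₁ : Q₁ = r - q + σ ^ 2 * (2 * γ + 2 * θ - 1) / 2)
    -- the unvested (tilde) coefficients
    (At Bt : ℕ → ℝ) (Et Ft : ℕ → ℕ → ℝ) (Ets Fts Pm Qm : ℕ → ℝ)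
    (hAt : ∀ m, 1 ≤ m → m ≤ M → At m = κt * A m / (q + α + κt))
    (hBt : ∀ m, 1 ≤ m → m ≤ M → Bt m = κt * B m / (r + α + κt))
    (hEt_zero : ∀ m n, m ≤ n → Et m n = 0)
    (hFt_zero : ∀ m n, m ≤ n → Ft m n = 0)
    (hEt_top : ∀ m, 1 ≤ m → m ≤ M → Et m (m - 1) = -(κt * E m (m - 1)) / R)
    (hFt_top : ∀ m, 1 ≤ m → m ≤ M → Ft m (m - 1) = -(κt * F m (m - 1)) / R)
    (hEt_sub : ∀ m, 2 ≤ m → m ≤ M →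
      Et m (m - 2) = -(κt * E m (m - 2) + ((m : ℝ) - 1) * P₁ * Et m (m - 1)) / R)
    (hFt_sub : ∀ m, 2 ≤ m → m ≤ M →
      Ft m (m - 2) = -(κt * F m (m - 2) + ((m : ℝ) - 1) * Q₁ * Ft m (m - 1)) / R)
    (hEt_low : ∀ m, 3 ≤ m → m ≤ M → ∀ n, n + 3 ≤ m →
      Et m n = -(2 * κt * E m n + 2 * ((n : ℝ) + 1) * P₁ * Et m (n + 1)
        + σ ^ 2 * ((n : ℝ) + 2) * ((n : ℝ) + 1) * Et m (n + 2)) / (2 * R))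
    (hFt_low : ∀ m, 3 ≤ m → m ≤ M → ∀ n, n + 3 ≤ m →
      Ft m n = -(2 * κt * F m n + 2 * ((n : ℝ) + 1) * Q₁ * Ft m (n + 1)
        + σ ^ 2 * ((n : ℝ) + 2) * ((n : ℝ) + 1) * Ft m (n + 2)) / (2 * R))
    (hPm : ∀ m, 1 ≤ m → m ≤ M → Pm m = Ft m 0 - Et m 0 - K * At m - K * Bt m)
    (hQm : ∀ m, 1 ≤ m → m ≤ M →
      Qm m = (γ + θ) * Ft m 0 - (γ - θ) * Et m 0 - K * At m + Ft m 1 - Et m 1)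
    (hEts : ∀ m, 1 ≤ m → m ≤ M → Ets m = ((γt + θt) * Pm m - Qm m) / (2 * θt))
    (hFts : ∀ m, 1 ≤ m → m ≤ M → Fts m = ((γt - θt) * Pm m - Qm m) / (2 * θt))
    -- the unvested value
    (Ct : ℕ → ℝ → ℝ)
    (hCt : ∀ m s, Ct m s =
      if K < s then
        At m * s + Bt m * K
          + (∑ n ∈ Finset.range m, Et m n * (Real.log (s / K)) ^ n * (s / K) ^ (γ - θ))
          + Ets m * (s / K) ^ (γt - θt)
      else (∑ n ∈ Finset.range m, Ft m n * (Real.log (s / K)) ^ n * (s / K) ^ (γ + θ))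
          + Fts m * (s / K) ^ (γt + θt)) :
    ∀ m, 1 ≤ m → m ≤ M →
      (∀ s : ℝ, s ∈ Set.Ioo 0 K ∪ Set.Ioi K →
        DifferentiableAt ℝ (Ct m) s ∧ DifferentiableAt ℝ (deriv (Ct m)) s ∧
        -(r + α + κt) * Ct m s + (r - q) * s * deriv (Ct m) s
          + σ ^ 2 * s ^ 2 / 2 * deriv (deriv (Ct m)) s + κt * C m s = 0) ∧
      (∃ L : ℝ, Tendsto (Ct m) (nhdsWithin K (Set.Iio K)) (nhds L) ∧
        Tendsto (Ct m) (nhdsWithin K (Set.Ioi K)) (nhds L)) ∧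
      (∃ L' : ℝ, Tendsto (deriv (Ct m)) (nhdsWithin K (Set.Iio K)) (nhds L') ∧
        Tendsto (deriv (Ct m)) (nhdsWithin K (Set.Ioi K)) (nhds L')) := by
  intro m hm1 hmM
  subst hγt
  have hσ2 : (0 : ℝ) < σ ^ 2 := by positivity
  have hargt : 0 < γt ^ 2 + 2 * (r + α + κt) / σ ^ 2 := by
    have : 0 < 2 * (r + α + κt) / σ ^ 2 := by positivity
    positivity
  have harg : 0 < γt ^ 2 + 2 * (r + lam + β + κ) / σ ^ 2 := by
    have : 0 < 2 * (r + lam + β + κ) / σ ^ 2 := by positivity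
    positivity
  have hθtpos : 0 < θt := by rw [hθt]; exact Real.sqrt_pos.mpr hargt
  have hθtsq : σ ^ 2 * θt ^ 2 = σ ^ 2 * γt ^ 2 + 2 * (r + α + κt) := by
    rw [hθt, Real.sq_sqrt hargt.le]; field_simp
  have hθsq : σ ^ 2 * θ ^ 2 = σ ^ 2 * γt ^ 2 + 2 * (r + lam + β + κ) := by
    rw [hθ, Real.sq_sqrt harg.le]; field_simp
  have hγ2 : σ ^ 2 * γt = σ ^ 2 / 2 - (r - q) := by
    rw [hγ]; field_simp
  have recE := rec_unify m hm1 R κt P₁ σ hR (E m) (Et m) (hEt_zero m) (hEt_top m hm1 hmM)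
    (fun h => hEt_sub m h hmM) (fun n hn => hEt_low m (by omega) hmM n hn)
  have recF := rec_unify m hm1 R κt Q₁ σ hR (F m) (Ft m) (hFt_zero m) (hFt_top m hm1 hmM)
    (fun h => hFt_sub m h hmM) (fun n hn => hFt_low m (by omega) hmM n hn)
  set dE : ℕ → ℝ := fun n => if n = 0 then Ets m else 0 with hdE
  set dF : ℕ → ℝ := fun n => if n = 0 then Fts m else 0 with hdF
  have hdE0 : ∀ n, 1 ≤ n → dE n = 0 := fun n hn => if_neg (by omega)
  have hdF0 : ∀ n, 1 ≤ n → dF n = 0 := fun n hn => if_neg (by omega)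
  have fE : ∀ s ∈ Set.Ioi K, Ct m s
      = GG K (At m) (Bt m * K) (Et m) m (γt - θ) dE (γt - θt) s := by
    intro s hs
    rw [hCt, if_pos (Set.mem_Ioi.mp hs)]
    simp [GG, SS, hdE]
  have fF : ∀ s ∈ Set.Ioo 0 K, Ct m s
      = GG K 0 0 (Ft m) m (γt + θ) dF (γt + θt) s := by
    intro s hs
    rw [hCt, if_neg (not_lt.mpr hs.2.le)]
    simp [GG, SS, hdF]
  have posE : ∀ s ∈ Set.Ioi K, 0 < s := fun s hs => hK.trans hs
  have posF : ∀ s ∈ Set.Ioo 0 K, 0 < s := fun s hs => hs.1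
  have cE : ∀ s ∈ Set.Ioi K, C m s = A m * s + B m * K + SS K (E m) m (γt - θ) s := by
    intro s hs
    rw [hC, if_pos (Set.mem_Ioi.mp hs), SS]
  have cF : ∀ s ∈ Set.Ioo 0 K, C m s = 0 * s + 0 + SS K (F m) m (γt + θ) s := by
    intro s hs
    rw [hC, if_neg (not_lt.mpr hs.2.le), SS]; ring
  have hAt' : (q + α + κt) * At m = κt * A m := by rw [hAt m hm1 hmM]; field_simp
  have hBt' : (r + α + κt) * Bt m = κt * B m := by rw [hBt m hm1 hmM]; field_simp
  refine ⟨?_, ?_⟩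
  · rintro s (hs | hs)
    · have := GG_ode K 0 0 (r + α + κt) (r - q) (σ ^ 2 / 2) κt 0 0 hK (Ft m) (F m) m (γt + θ) dF
        (γt + θt) (hFt_zero m) hdF0 (Set.Ioo 0 K) isOpen_Ioo posF (Ct m) (C m) fF cF
        (by ring) (by ring)
        (by linear_combination (1 / 2 : ℝ) * hθtsq + (γt + θt) * hγ2)
        (fun n hn => by
          have := recF n hn
          rw [hR_def, hQ₁] at this
          linear_combination this + Ft m n * ((1 / 2 : ℝ) * hθsq + (γt + θ) * hγ2)) s hs
      refine ⟨this.1, this.2.1, ?_⟩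
      linear_combination this.2.2
    · have := GG_ode K (At m) (Bt m * K) (r + α + κt) (r - q) (σ ^ 2 / 2) κt (A m) (B m * K) hK
        (Et m) (E m) m (γt - θ) dE
        (γt - θt) (hEt_zero m) hdE0 (Set.Ioi K) isOpen_Ioi posE (Ct m) (C m) fE cE
        (by linear_combination -hAt') (by linear_combination -K * hBt')
        (by linear_combination (1 / 2 : ℝ) * hθtsq + (γt - θt) * hγ2)
        (fun n hn => by
          have := recE n hn
          rw [hR_def, hP₁] at this
          linear_combination this + Et m n * ((1 / 2 : ℝ) * hθsq + (γt - θ) * hγ2)) s hs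
      refine ⟨this.1, this.2.1, ?_⟩
      linear_combination this.2.2
  · have lF := GG_lim K 0 0 hK (Ft m) m hm1 (γt + θ) dF (γt + θt) (hFt_zero m) hdF0
      (Set.Ioo 0 K) (Set.Iio K) isOpen_Ioo posF (Ct m) fF (Ioo_mem_nhdsLT hK)
    have lE := GG_lim K (At m) (Bt m * K) hK (Et m) m hm1 (γt - θ) dE (γt - θt) (hEt_zero m) hdE0
      (Set.Ioi K) (Set.Ioi K) isOpen_Ioi posE (Ct m) fE self_mem_nhdsWithin
    have hE0 : dE 0 = Ets m := by simp [hdE]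
    have hF0 : dF 0 = Fts m := by simp [hdF]
    have m0 : Ets m - Fts m = Pm m := by
      rw [hEts m hm1 hmM, hFts m hm1 hmM]; field_simp; ring
    have m1 : (γt - θt) * Ets m - (γt + θt) * Fts m = Qm m := by
      rw [hEts m hm1 hmM, hFts m hm1 hmM]; field_simp; ring
    rw [hPm m hm1 hmM] at m0
    rw [hQm m hm1 hmM] at m1
    refine ⟨⟨_, lF.1, ?_⟩, ⟨_, lF.2, ?_⟩⟩
    · convert lE.1 using 2
      rw [hE0, hF0]
      linear_combination -m0
    · convert lE.2 using 2
      rw [hE0, hF0]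
      field_simp
      linear_combination -m1
end

section
/- Fix h ∈ ℂ with h ≠ 0, φ ∈ ℂ, reals λ ≥ 0, β ≥ 0, T ∈ ℝ, and for 1 ≤ m ≤ M define recursively: F⁽ᵐ⁾ = (1/h)(λΣ_{z=1}^{m−1}p_{m,z}F⁽ᵐ⁻ᶻ⁾ + (λp̄_m+mβ)φ); F_k⁽ᵐ⁾ = (λ/k)Σ_{z=1}^{m−k}p_{m,z}F_{k−1}⁽ᵐ⁻ᶻ⁾ for 1 ≤ k ≤ m−1; F₀⁽ᵐ⁾ = mφ − F⁽ᵐ⁾. Define y_m(t) = Σ_{k=0}^{m−1}F_k⁽ᵐ⁾(T−t)ᵏ e^{−(T−t)h} + F⁽ᵐ⁾ for t ∈ ℝ. Then for every 1 ≤ m ≤ M: y_m(T) = mφ, and y_m′(t) = h·y_m(t) − λΣ_{z=1}^{m−1}p_{m,z}y_{m−z}(t) − (λp̄_m+mβ)φ for all t; i.e., the closed-form family (y_m) solves the triangular system of linear ODEs dF[f⁽ᵐ⁾]/dt = hF[f⁽ᵐ⁾] + ψ⁽ᵐ⁾ with ψ⁽ᵐ⁾ = −λΣ_{z=1}^{m−1}p_{m,z}F[f⁽ᵐ⁻ᶻ⁾]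 − (λp̄_m+mβ)φ and terminal condition F[f⁽ᵐ⁾](T) = mφ. -/
/-- The constant-intensity closed form
y_m(t) = Σ_{k=0}^{m−1} F_k⁽ᵐ⁾ (T−t)ᵏ e^{−(T−t)h} + F⁽ᵐ⁾, with coefficients given by the stated
recursions, satisfies y_m(T) = mφ and the triangular system of linear ODEs
y_m′(t) = h·y_m(t) − λΣ_{z=1}^{m−1}p_{m,z}y_{m−z}(t) − (λp̄_m+mβ)φ. -/
theorem stmt_13 (M : ℕ) (hM : 1 ≤ M)
    (p : ℕ → ℕ → ℝ)
    (hp_nonneg : ∀ m z, 1 ≤ m → m ≤ M → 1 ≤ z → z ≤ m → 0 ≤ p m z)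
    (hp_sum : ∀ m, 1 ≤ m → m ≤ M → ∑ z ∈ Finset.Icc 1 m, p m z = 1)
    (pbar : ℕ → ℝ)
    (hpbar : ∀ m, pbar m = ∑ z ∈ Finset.Icc 1 m, (z : ℝ) * p m z)
    (h : ℂ) (hh : h ≠ 0) (φ : ℂ) (lam β T : ℝ) (hlam : 0 ≤ lam) (hβ : 0 ≤ β)
    (Fm : ℕ → ℂ) (Fk : ℕ → ℕ → ℂ)
    (hFm : ∀ m, 1 ≤ m → m ≤ M →
      Fm m = (1 / h) * ((lam : ℂ) * ∑ z ∈ Finset.Icc 1 (m - 1), (p m z : ℂ) * Fm (m - z)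
        + ((lam : ℂ) * (pbar m : ℂ) + (m : ℂ) * (β : ℂ)) * φ))
    (hFk : ∀ m, 1 ≤ m → m ≤ M → ∀ k, 1 ≤ k → k ≤ m - 1 →
      Fk m k = ((lam : ℂ) / (k : ℂ))
        * ∑ z ∈ Finset.Icc 1 (m - k), (p m z : ℂ) * Fk (m - z) (k - 1))
    (hF0 : ∀ m, 1 ≤ m → m ≤ M → Fk m 0 = (m : ℂ) * φ - Fm m)
    (y : ℕ → ℝ → ℂ)
    (hy : ∀ m t, y m t =
      (∑ k ∈ Finset.range m, Fk m k * ((T - t : ℝ) : ℂ) ^ k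
        * Complex.exp (-(((T - t : ℝ) : ℂ) * h))) + Fm m) :
    ∀ m, 1 ≤ m → m ≤ M →
      y m T = (m : ℂ) * φ ∧
      ∀ t : ℝ, HasDerivAt (y m)
        (h * y m t - (lam : ℂ) * ∑ z ∈ Finset.Icc 1 (m - 1), (p m z : ℂ) * y (m - z) t
          - ((lam : ℂ) * (pbar m : ℂ) + (m : ℂ) * (β : ℂ)) * φ) t := by
  intro m hm1 hmM
  obtain ⟨n, rfl⟩ : ∃ n, m = n + 1 := ⟨m - 1, by omega⟩
  refine ⟨?_, ?_⟩
  · rw [hy, Finset.sum_range_succ']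
    simp [hF0 (n + 1) hm1 hmM]
  · intro t
    have hfun : y (n + 1) = fun t : ℝ => (∑ k ∈ Finset.range (n + 1),
        Fk (n + 1) k * ((T - t : ℝ) : ℂ) ^ k
        * Complex.exp (-(((T - t : ℝ) : ℂ) * h))) + Fm (n + 1) := funext (hy (n + 1))
    have hs : HasDerivAt (fun t : ℝ => ((T - t : ℝ) : ℂ)) (-1) t := by
      have := ((hasDerivAt_id t).const_sub T).ofReal_comp
      simpa using this
    have hE : HasDerivAt (fun t : ℝ => Complex.exp (-(((T - t : ℝ) : ℂ) * h)))
        (Complex.exp (-(((T - t : ℝ) : ℂ) * h)) * (-(-1 * h))) t :=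
      ((hs.mul_const h).neg).cexp
    have hD := (HasDerivAt.fun_sum (u := Finset.range (n + 1)) (fun k _ =>
      ((hs.pow k).const_mul (Fk (n + 1) k)).mul hE)).add_const (Fm (n + 1))
    have hfm : h * Fm (n + 1) = (lam : ℂ) * ∑ z ∈ Finset.Icc 1 n, (p (n + 1) z : ℂ)
        * Fm (n + 1 - z)
        + ((lam : ℂ) * (pbar (n + 1) : ℂ) + ((n + 1 : ℕ) : ℂ) * (β : ℂ)) * φ := by
      rw [hFm (n + 1) hm1 hmM, ← mul_assoc, mul_one_div_cancel hh, one_mul]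
      rfl
    rw [hfun]
    refine HasDerivAt.congr_deriv hD ?_
    simp only [hy, Nat.add_sub_cancel, Pi.pow_apply]
    generalize ((T - t : ℝ) : ℂ) = s
    generalize Complex.exp (-(s * h)) = E
    have key : ∑ k ∈ Finset.range n, ((k : ℂ) + 1) * Fk (n + 1) (k + 1) * s ^ k * E
        = (lam : ℂ) * ∑ z ∈ Finset.Icc 1 n, (p (n + 1) z : ℂ)
          * ∑ k ∈ Finset.range (n + 1 - z), Fk (n + 1 - z) k * s ^ k * E := by
      have h1 : ∀ k ∈ Finset.range n, ((k : ℂ) + 1) * Fk (n + 1) (k + 1) * s ^ k * E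
          = ∑ z ∈ Finset.Icc 1 (n - k), (lam : ℂ) * ((p (n + 1) z : ℂ)
            * (Fk (n + 1 - z) k * s ^ k * E)) := by
        intro k hk
        have hk' := Finset.mem_range.mp hk
        have hne : (k : ℂ) + 1 ≠ 0 := by exact_mod_cast Nat.succ_ne_zero k
        rw [hFk (n + 1) hm1 hmM (k + 1) (by omega) (by omega)]
        have e : n + 1 - (k + 1) = n - k := by omega
        rw [e, Nat.add_sub_cancel]
        push_cast
        rw [← mul_assoc, mul_div_cancel₀ _ hne, Finset.mul_sum, Finset.sum_mul, Finset.sum_mul]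
        exact Finset.sum_congr rfl fun z _ => by ring
      rw [Finset.sum_congr rfl h1]
      simp only [Finset.mul_sum]
      apply Finset.sum_comm'
      intro k z
      simp only [Finset.mem_range, Finset.mem_Icc]
      omega
    have hder : ∑ k ∈ Finset.range (n + 1), (k : ℂ) * Fk (n + 1) k * s ^ (k - 1) * E
        = ∑ k ∈ Finset.range n, ((k : ℂ) + 1) * Fk (n + 1) (k + 1) * s ^ k * E := by
      rw [Finset.sum_range_succ']
      simp
    have hL : ∀ A : ℕ → ℂ, (∀ k, A k = h * (Fk (n + 1) k * s ^ k * E)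
        - (k : ℂ) * Fk (n + 1) k * s ^ (k - 1) * E) →
        ∑ k ∈ Finset.range (n + 1), A k
          = h * (∑ k ∈ Finset.range (n + 1), Fk (n + 1) k * s ^ k * E)
          - ∑ k ∈ Finset.range (n + 1), (k : ℂ) * Fk (n + 1) k * s ^ (k - 1) * E := by
      intro A hA
      rw [Finset.mul_sum, ← Finset.sum_sub_distrib]
      exact Finset.sum_congr rfl fun k _ => hA k
    refine (hL _ ?_).trans ?_
    · intro k
      ring
    · rw [hder, key]
      simp only [mul_add, Finset.sum_add_distrib]
      rw [hfm]
      ring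
end

section
/- Let t_v < T be reals, B : [t_v,T] → ℝ continuous, and let h, ψ : [t_v,T] × ℂ → ℂ be continuous, with h(s,·) and ψ(s,·) complex-differentiable on ℂ for each s and with jointly continuous ω-derivatives; let G : ℂ → ℂ be complex-differentiable. Write I(s,t) = ∫_s^t B(u)du and define, for t ∈ [t_v,T] and ω ∈ ℂ, F(t,ω) = exp(−∫_t^T h(s, ω − i·I(s,t))ds)·G(ω + i·I(t,T)) + ∫_t^T exp(−∫_t^τ h(s, ω − i·I(s,t))ds)·ψ(τ, ω + i·I(t,τ))dτ. Then F(T,ω) = G(ω) for all ω, and for all t ∈ (t_v,T) and ω ∈ ℂ, ∂_tF(t,ω) + iB(t)·∂_ωF(t,ω) − h(t,ω)F(t,ω) + ψ(t,ω) = 0; i.e., the method-of-characteristics formula solves the first-order terminal-value PDE arising from the Fourier transform of the valuation equation with stock-dependent exercise intensity. -/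
/-- Jointly continuous family with jointly continuous complex derivative. -/
structure NiceFam (f f' : ℝ → ℂ → ℂ) : Prop where
  cont : Continuous (fun z : ℝ × ℂ => f z.1 z.2)
  dcont : Continuous (fun z : ℝ × ℂ => f' z.1 z.2)
  der : ∀ s z, HasDerivAt (f s) (f' s z) z

theorem prim_cont {f : ℝ → ℂ → ℂ} (hf : Continuous (fun z : ℝ × ℂ => f z.1 z.2)) (c : ℝ) :
    Continuous (fun z : ℝ × ℂ => ∫ s in c..z.1, f s z.2) := by
  have h1 : Continuous (Function.uncurry (fun (z : ℝ × ℂ) (s : ℝ) => f s z.2)) :=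
    hf.comp (by fun_prop : Continuous (fun x : (ℝ × ℂ) × ℝ => (x.2, x.1.2)))
  exact intervalIntegral.continuous_parametric_intervalIntegral_of_continuous h1 continuous_fst

theorem NiceFam.sec {f f' : ℝ → ℂ → ℂ} (hf : NiceFam f f') (z : ℂ) :
    Continuous (fun s => f s z) :=
  hf.cont.comp (by fun_prop : Continuous (fun s : ℝ => (s, z)))

theorem NiceFam.dsec {f f' : ℝ → ℂ → ℂ} (hf : NiceFam f f') (z : ℂ) :
    Continuous (fun s => f' s z) :=
  hf.dcont.comp (by fun_prop : Continuous (fun s : ℝ => (s, z)))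

theorem NiceFam.prim {f f' : ℝ → ℂ → ℂ} (hf : NiceFam f f') (c : ℝ) :
    NiceFam (fun a z => ∫ s in c..a, f s z) (fun a z => ∫ s in c..a, f' s z) := by
  refine ⟨prim_cont hf.cont c, prim_cont hf.dcont c, fun a z => ?_⟩
  have hK : IsCompact (Set.uIcc c a ×ˢ Metric.closedBall z 1) :=
    isCompact_uIcc.prod (isCompact_closedBall z 1)
  obtain ⟨C, hC⟩ := hK.exists_bound_of_continuousOn hf.dcont.continuousOn
  refine (intervalIntegral.hasDerivAt_integral_of_dominated_loc_of_deriv_le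
    (F := fun z s => f s z) (F' := fun z s => f' s z) (bound := fun _ => C)
    (Metric.closedBall_mem_nhds z one_pos) ?_ ?_ ?_ ?_ ?_ ?_).2
  · exact Filter.Eventually.of_forall fun x => (hf.sec x).aestronglyMeasurable
  · exact (hf.sec z).intervalIntegrable _ _
  · exact (hf.dsec z).aestronglyMeasurable
  · refine Filter.Eventually.of_forall fun s hs x hx => ?_
    exact hC (s, x) ⟨Set.uIoc_subset_uIcc hs, hx⟩
  · exact intervalIntegrable_const
  · exact Filter.Eventually.of_forall fun s _ x _ => hf.der s x

theorem NiceFam.chain {f f' : ℝ → ℂ → ℂ} (hf : NiceFam f f') (c t : ℝ) {γ : ℝ → ℂ} {γ' : ℂ}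
    (hγ : HasDerivAt γ γ' t) :
    HasDerivAt (fun a => ∫ s in c..a, f s (γ a))
      (f t (γ t) + (∫ s in c..t, f' s (γ t)) * γ') t := by
  have hp := hf.prim c
  have key := hasStrictFDerivAt_uncurry_coprod (𝕜 := ℝ) (u := (t, γ t))
    (f := fun (a : ℝ) (z : ℂ) => ∫ s in c..a, f s z)
    (f₁ := fun a z => ContinuousLinearMap.toSpanSingleton ℝ (f a z))
    (f₂ := fun a z => (ContinuousLinearMap.toSpanSingleton ℂ
      (∫ s in c..a, f' s z)).restrictScalars ℝ)
    (Filter.Eventually.of_forall fun v => by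
      have := intervalIntegral.integral_hasDerivAt_right
        ((hf.sec v.2).intervalIntegrable c v.1)
        ((hf.sec v.2).stronglyMeasurableAtFilter _ _) (hf.sec v.2).continuousAt
      exact this.hasFDerivAt)
    (Filter.Eventually.of_forall fun v => (hp.der v.1 v.2).hasFDerivAt.restrictScalars ℝ)
    (by
      have h2 : Continuous (fun v : ℝ × ℂ => ContinuousLinearMap.toSpanSingleton ℝ (f v.1 v.2)) :=
        (ContinuousLinearMap.toSpanSingletonCLE (𝕜 := ℝ) (E := ℂ)).continuous.comp hf.cont
      exact h2.continuousAt)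
    (by
      have h2 : Continuous (fun v : ℝ × ℂ => (ContinuousLinearMap.toSpanSingleton ℂ
          (∫ s in c..v.1, f' s v.2)).restrictScalars ℝ) :=
        (ContinuousLinearMap.restrictScalarsL ℂ ℂ ℂ ℝ ℝ).continuous.comp
          ((ContinuousLinearMap.toSpanSingletonCLE (𝕜 := ℂ) (E := ℂ)).continuous.comp hp.dcont)
      exact h2.continuousAt)
  have h3 := key.hasFDerivAt.comp_hasDerivAt t
    (f := fun a => (a, γ a)) ((hasDerivAt_id t).prodMk hγ)
  refine HasDerivAt.congr_deriv (f' := _) h3 ?_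
  change (ContinuousLinearMap.coprod (ContinuousLinearMap.toSpanSingleton ℝ (f t (γ t)))
    ((ContinuousLinearMap.toSpanSingleton ℂ
      (∫ s in c..t, f' s (γ t))).restrictScalars ℝ)) (1, γ') = _
  simp [mul_comm]

theorem global_pde (A : ℝ → ℝ) (B : ℝ → ℝ) (tv T : ℝ) (hA : ∀ t, HasDerivAt A (B t) t)
    (h h' ψ ψ' : ℝ → ℂ → ℂ) (hh : NiceFam h h') (hψ : NiceFam ψ ψ')
    (G : ℂ → ℂ) (hG : Differentiable ℂ G) (t : ℝ) (ω : ℂ) (F : ℝ → ℂ → ℂ)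
    (hF : ∀ᶠ t' in nhds t, ∀ w, F t' w =
      Complex.exp (-(∫ s in t'..T, h s (w - Complex.I * ((A t' - A s : ℝ) : ℂ))))
        * G (w + Complex.I * ((A T - A t' : ℝ) : ℂ))
      + ∫ τ in t'..T,
          Complex.exp (-(∫ s in t'..τ, h s (w - Complex.I * ((A t' - A s : ℝ) : ℂ))))
            * ψ τ (w + Complex.I * ((A τ - A t' : ℝ) : ℂ))) :
    deriv (fun t' : ℝ => F t' ω) t + Complex.I * (B t : ℂ) * deriv (fun w : ℂ => F t w) ω
        - h t ω * F t ω + ψ t ω = 0 := by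
  have hAc : Continuous A := continuous_iff_continuousAt.2 fun t => (hA t).continuousAt
  have shift : ∀ f f' : ℝ → ℂ → ℂ, NiceFam f f' →
      NiceFam (fun s z => f s (z + Complex.I * A s)) (fun s z => f' s (z + Complex.I * A s)) := by
    intro f f' hf
    have hc : Continuous (fun v : ℝ × ℂ => (v.1, v.2 + Complex.I * A v.1)) := by fun_prop
    refine ⟨hf.cont.comp hc, hf.dcont.comp hc, fun s z => ?_⟩
    simpa using (hf.der s (z + Complex.I * A s)).comp_add_const z (Complex.I * A s)
  obtain ⟨p, hpdef⟩ : ∃ p : ℝ → ℂ → ℂ, p = fun s z => h s (z + Complex.I * A s) := ⟨_, rfl⟩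
  obtain ⟨p', hp'⟩ : ∃ p', NiceFam p p' := ⟨_, hpdef ▸ shift h h' hh⟩
  obtain ⟨r, hrdef⟩ : ∃ r : ℝ → ℂ → ℂ, r = fun s z => ψ s (z + Complex.I * A s) := ⟨_, rfl⟩
  obtain ⟨r', hr'⟩ : ∃ r', NiceFam r r' := ⟨_, hrdef ▸ shift ψ ψ' hψ⟩
  obtain ⟨H, hH⟩ : ∃ H : ℝ → ℂ → ℂ, H = fun a z => ∫ s in tv..a, p s z := ⟨_, rfl⟩
  obtain ⟨H', hH'⟩ : ∃ H' : ℝ → ℂ → ℂ, H' = fun a z => ∫ s in tv..a, p' s z := ⟨_, rfl⟩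
  have hHn : NiceFam H H' := by rw [hH, hH']; exact hp'.prim tv
  obtain ⟨q, hqdef⟩ : ∃ q : ℝ → ℂ → ℂ, q = fun s z => Complex.exp (-H s z) * r s z := ⟨_, rfl⟩
  obtain ⟨q', hq'⟩ : ∃ q', NiceFam q q' := by
    refine ⟨fun s z => (Complex.exp (-H s z) * (-H' s z)) * r s z
      + Complex.exp (-H s z) * r' s z, ?_⟩
    rw [hqdef]
    have h1 := hHn.cont
    have h2 := hHn.dcont
    have h3 := hr'.cont
    have h4 := hr'.dcont
    refine ⟨by fun_prop, by fun_prop, fun s z => ?_⟩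
    exact ((hHn.der s z).neg.cexp).mul (hr'.der s z)
  obtain ⟨P, hP⟩ : ∃ P : ℝ → ℂ → ℂ, P = fun a z => ∫ s in tv..a, q s z := ⟨_, rfl⟩
  obtain ⟨P', hP'⟩ : ∃ P' : ℝ → ℂ → ℂ, P' = fun a z => ∫ s in tv..a, q' s z := ⟨_, rfl⟩
  have hPn : NiceFam P P' := by rw [hP, hP']; exact hq'.prim tv
  obtain ⟨K, hK⟩ : ∃ K : ℂ → ℂ, K = fun z =>
    Complex.exp (-H T z) * G (z + Complex.I * A T) + P T z := ⟨_, rfl⟩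
  obtain ⟨K', hK'⟩ : ∃ K' : ℂ → ℂ, ∀ z, HasDerivAt K (K' z) z := by
    have : Differentiable ℂ K := by
      have h1 : Differentiable ℂ (H T) := fun z => (hHn.der T z).differentiableAt
      have h2 : Differentiable ℂ (P T) := fun z => (hPn.der T z).differentiableAt
      rw [hK]
      fun_prop
    exact ⟨deriv K, fun z => (this z).hasDerivAt⟩
  have hF2 : ∀ᶠ t' in nhds t, ∀ w, F t' w =
      Complex.exp (H t' (w - Complex.I * A t')) *
        (K (w - Complex.I * A t') - P t' (w - Complex.I * A t')) := by
    filter_upwards [hF] with t' ht' w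
    rw [ht' w]
    have e1 : ∀ b, (∫ s in t'..b, h s (w - Complex.I * ((A t' - A s : ℝ) : ℂ)))
        = H b (w - Complex.I * A t') - H t' (w - Complex.I * A t') := by
      intro b
      rw [hH]
      simp only []
      rw [intervalIntegral.integral_interval_sub_left ((hp'.sec _).intervalIntegrable _ _)
        ((hp'.sec _).intervalIntegrable _ _), hpdef]
      congr 1
      funext s
      push_cast
      ring_nf
    have e2 : ∀ b, Complex.exp (-(∫ s in t'..b, h s (w - Complex.I * ((A t' - A s : ℝ) : ℂ))))
        = Complex.exp (H t' (w - Complex.I * A t')) *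
          Complex.exp (-H b (w - Complex.I * A t')) := by
      intro b
      rw [e1, ← Complex.exp_add]
      ring_nf
    have e3 : (∫ τ in t'..T,
          Complex.exp (-(∫ s in t'..τ, h s (w - Complex.I * ((A t' - A s : ℝ) : ℂ))))
            * ψ τ (w + Complex.I * ((A τ - A t' : ℝ) : ℂ)))
        = Complex.exp (H t' (w - Complex.I * A t')) *
          (P T (w - Complex.I * A t') - P t' (w - Complex.I * A t')) := by
      rw [hP]
      simp only []
      rw [intervalIntegral.integral_interval_sub_left ((hq'.sec _).intervalIntegrable _ _)
        ((hq'.sec _).intervalIntegrable _ _), ← intervalIntegral.integral_const_mul, hqdef, hrdef]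
      congr 1
      funext s
      rw [e2, mul_assoc]
      push_cast
      ring_nf
    rw [e2, e3, hK]
    push_cast
    ring_nf
  have hFt := hF2.self_of_nhds
  have hγ : HasDerivAt (fun a : ℝ => ω - Complex.I * (A a : ℂ)) (-(Complex.I * (B t : ℂ))) t := by
    simpa using ((hA t).ofReal_comp.const_mul Complex.I).const_sub ω
  have dH : HasDerivAt (fun a : ℝ => H a (ω - Complex.I * (A a : ℂ)))
      (p t (ω - Complex.I * (A t : ℂ)) + (∫ s in tv..t, p' s (ω - Complex.I * (A t : ℂ)))
        * (-(Complex.I * (B t : ℂ)))) t := by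
    have := hp'.chain tv t hγ
    rw [hH]; exact this
  have dP : HasDerivAt (fun a : ℝ => P a (ω - Complex.I * (A a : ℂ)))
      (q t (ω - Complex.I * (A t : ℂ)) + (∫ s in tv..t, q' s (ω - Complex.I * (A t : ℂ)))
        * (-(Complex.I * (B t : ℂ)))) t := by
    have := hq'.chain tv t hγ
    rw [hP]; exact this
  have dK : HasDerivAt (fun a : ℝ => K (ω - Complex.I * (A a : ℂ)))
      ((-(Complex.I * (B t : ℂ))) • K' (ω - Complex.I * (A t : ℂ))) t :=
    (hK' _).scomp t hγ
  have d1 := (dH.cexp.mul (dK.sub dP)).congr_of_eventuallyEq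
    (f₁ := fun t' => F t' ω) (hF2.mono fun t' ht' => ht' ω)
  have hz : HasDerivAt (fun w : ℂ => w - Complex.I * (A t : ℂ)) 1 ω :=
    (hasDerivAt_id ω).sub_const _
  have d2 := (((hHn.der t _).comp ω hz).cexp.mul
    (((hK' _).comp ω hz).sub ((hPn.der t _).comp ω hz))).congr_of_eventuallyEq
    (f₁ := fun w => F t w) (Filter.Eventually.of_forall hFt)
  rw [d1.deriv, d2.deriv, hFt ω]
  have eH' : (∫ s in tv..t, p' s (ω - Complex.I * (A t : ℂ))) = H' t (ω - Complex.I * (A t : ℂ)) := by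
    rw [hH']
  have eP' : (∫ s in tv..t, q' s (ω - Complex.I * (A t : ℂ))) = P' t (ω - Complex.I * (A t : ℂ)) := by
    rw [hP']
  have ep : p t (ω - Complex.I * (A t : ℂ)) = h t ω := by rw [hpdef]; simp
  have eq : q t (ω - Complex.I * (A t : ℂ)) =
      Complex.exp (-H t (ω - Complex.I * (A t : ℂ))) * ψ t ω := by rw [hqdef, hrdef]; simp
  have ee : Complex.exp (H t (ω - Complex.I * (A t : ℂ))) *
      Complex.exp (-H t (ω - Complex.I * (A t : ℂ))) = 1 := by
    rw [← Complex.exp_add]; simp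
  rw [eH', eP', ep, eq]
  simp only [Function.comp, smul_eq_mul, Pi.sub_apply]
  linear_combination (-ψ t ω) * ee

/-- The method-of-characteristics formula, with I(s,t) = ∫_s^t B(u)du,
F(t,ω) = exp(−∫_t^T h(s, ω−i·I(s,t))ds)·G(ω+i·I(t,T))
          + ∫_t^T exp(−∫_t^τ h(s, ω−i·I(s,t))ds)·ψ(τ, ω+i·I(t,τ))dτ,
satisfies F(T,ω) = G(ω) and, on (t_v,T)×ℂ, the first-order terminal-value PDE
∂_tF + iB(t)∂_ωF − h(t,ω)F + ψ(t,ω) = 0. -/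
theorem stmt_14 (tv T : ℝ) (htv : tv < T)
    (B : ℝ → ℝ) (hB : ContinuousOn B (Set.Icc tv T))
    (h ψ : ℝ → ℂ → ℂ)
    (hh_cont : ContinuousOn (fun z : ℝ × ℂ => h z.1 z.2) (Set.Icc tv T ×ˢ Set.univ))
    (hψ_cont : ContinuousOn (fun z : ℝ × ℂ => ψ z.1 z.2) (Set.Icc tv T ×ˢ Set.univ))
    (hh_diff : ∀ s ∈ Set.Icc tv T, Differentiable ℂ (h s))
    (hψ_diff : ∀ s ∈ Set.Icc tv T, Differentiable ℂ (ψ s))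
    (hh_dcont : ContinuousOn (fun z : ℝ × ℂ => deriv (h z.1) z.2) (Set.Icc tv T ×ˢ Set.univ))
    (hψ_dcont : ContinuousOn (fun z : ℝ × ℂ => deriv (ψ z.1) z.2) (Set.Icc tv T ×ˢ Set.univ))
    (G : ℂ → ℂ) (hG : Differentiable ℂ G)
    (F : ℝ → ℂ → ℂ)
    (hF : ∀ t ω, F t ω =
      Complex.exp (-(∫ s in t..T, h s (ω - Complex.I * ((∫ u in s..t, B u : ℝ) : ℂ))))
        * G (ω + Complex.I * ((∫ u in t..T, B u : ℝ) : ℂ))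
      + ∫ τ in t..T,
          Complex.exp (-(∫ s in t..τ, h s (ω - Complex.I * ((∫ u in s..t, B u : ℝ) : ℂ))))
            * ψ τ (ω + Complex.I * ((∫ u in t..τ, B u : ℝ) : ℂ))) :
    (∀ ω : ℂ, F T ω = G ω) ∧
    ∀ t ∈ Set.Ioo tv T, ∀ ω : ℂ,
      deriv (fun t' : ℝ => F t' ω) t + Complex.I * (B t : ℂ) * deriv (fun w : ℂ => F t w) ω
        - h t ω * F t ω + ψ t ω = 0 := by
  refine ⟨fun ω => by rw [hF]; simp, ?_⟩
  intro t ht ω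
  have hle : tv ≤ T := htv.le
  obtain ⟨π, hπ⟩ : ∃ π : ℝ → ℝ, π = fun s => (Set.projIcc tv T hle s : ℝ) := ⟨_, rfl⟩
  have hπc : Continuous π := by
    rw [hπ]; exact continuous_subtype_val.comp continuous_projIcc
  have hπm : ∀ s, π s ∈ Set.Icc tv T := fun s => by rw [hπ]; exact Subtype.coe_prop _
  have hπe : ∀ s ∈ Set.Icc tv T, π s = s := fun s hs => by
    rw [hπ]; simp only [Set.projIcc_of_mem hle hs]
  have hBc : Continuous (fun u => B (π u)) := hB.comp_continuous hπc hπm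
  have ext : ∀ f : ℝ → ℂ → ℂ,
      ContinuousOn (fun z : ℝ × ℂ => f z.1 z.2) (Set.Icc tv T ×ˢ Set.univ) →
      Continuous (fun z : ℝ × ℂ => f (π z.1) z.2) := by
    intro f hf
    exact hf.comp_continuous (f := fun z : ℝ × ℂ => (π z.1, z.2)) (by fun_prop)
      (fun z => ⟨hπm _, Set.mem_univ _⟩)
  have nh : NiceFam (fun s => h (π s)) (fun s z => deriv (h (π s)) z) :=
    ⟨ext h hh_cont, ext (fun s z => deriv (h s) z) hh_dcont,
      fun s z => (hh_diff _ (hπm s) z).hasDerivAt⟩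
  have nψ : NiceFam (fun s => ψ (π s)) (fun s z => deriv (ψ (π s)) z) :=
    ⟨ext ψ hψ_cont, ext (fun s z => deriv (ψ s) z) hψ_dcont,
      fun s z => (hψ_diff _ (hπm s) z).hasDerivAt⟩
  obtain ⟨A, hA⟩ : ∃ A : ℝ → ℝ, A = fun a => ∫ u in tv..a, B (π u) := ⟨_, rfl⟩
  have hAd : ∀ a, HasDerivAt A (B (π a)) a := by
    intro a
    rw [hA]
    exact intervalIntegral.integral_hasDerivAt_right (hBc.intervalIntegrable _ _)
      (hBc.stronglyMeasurableAtFilter _ _) hBc.continuousAt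
  have hAi : ∀ a ∈ Set.Icc tv T, ∀ b ∈ Set.Icc tv T, ∫ u in a..b, B u = A b - A a := by
    intro a ha b hb
    rw [hA]
    simp only []
    rw [intervalIntegral.integral_interval_sub_left (hBc.intervalIntegrable _ _)
      (hBc.intervalIntegrable _ _)]
    refine intervalIntegral.integral_congr fun u hu => ?_
    simp only [hπe u (Set.uIcc_subset_Icc ha hb hu)]
  have hTm : T ∈ Set.Icc tv T := ⟨hle, le_rfl⟩
  have main := global_pde A (fun a => B (π a)) tv T hAd _ _ _ _ nh nψ G hG t ω F (by
    filter_upwards [Icc_mem_nhds ht.1 ht.2] with t' ht' w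
    rw [hF, hAi t' ht' T hTm]
    have e1 : ∀ b ∈ Set.Icc tv T,
        (∫ s in t'..b, h s (w - Complex.I * ((∫ u in s..t', B u : ℝ) : ℂ))) =
        ∫ s in t'..b, h (π s) (w - Complex.I * ((A t' - A s : ℝ) : ℂ)) := by
      intro b hb
      refine intervalIntegral.integral_congr fun s hs => ?_
      have hs' := Set.uIcc_subset_Icc ht' hb hs
      simp only [hπe s hs', hAi s hs' t' ht']
    rw [e1 T hTm]
    congr 1
    refine intervalIntegral.integral_congr fun s hs => ?_
    have hs' := Set.uIcc_subset_Icc ht' hTm hs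
    simp only [hπe s hs', hAi t' ht' s hs', e1 s hs'])
  simpa only [hπe t ⟨ht.1.le, ht.2.le⟩] using main
end
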